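/- Fix even integers λ_h ≥ 0 and λ_v ≥ 0, and consider σ₋ acting on (λ_h,λ_v)-families of forms. Let C¹ be the subspace of (λ_h,λ_v)-families of 1-forms spanned by the following three types of elements: (i) e(∂,∂̄)(G₁) · χ^{λ_v/2}, with G₁ ∈ ℂ[u¹,u²,ū¹,ū²] bihomogeneous of bidegree ((λ_h+λ_v)/2 + 1, (λ_h+λ_v)/2 + 1); (ii) e(u,ū)(G₂) · t^{λ_v/2}, with G₂ bihomogeneous of bidegree (λ_h/2 − 1, λ_h/2 − 1) (this type only for λ_h ≥ 2); (iii) (e(u,ū) · χ t^{λ_v/2 − 1} + (λ_h/(λ_h+λ_v+2)) · (e(∂,ū) + e(u,∂̄)) · t^{λ_v/2}) applied to G₃ bihomogeneous of bidegree (λ_h/2, λ_h/2) (this type only for λ_v ≥ 2). Then every element of C¹ is annihilated by σ₋; the kernel of σ₋ on (λ_h,λ_v)-families of 1-forms is the sum of C¹ and the image of σ₋ on (λ_h,λ_v)-families of 0-forms; and the natural map from C¹ to the quotient ker σ₋ / Im σ₋ is an isomorphism of ℂ-vector spaces (i.e. C¹ represents the cohomology H¹(σ₋) bijectively). -/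

import Mathlib

set_option synthInstance.maxSize 1000
set_option maxHeartbeats 1000000

/-!
Context for the σ₋-complex in the (adj ⊗ adj) sector.

* `Pu = ℂ[u¹,u²,ū¹,ū²]` is the polynomial ring in the auxiliary spinor variables,
  indexed by `Sum.inl α ↔ u^α` and `Sum.inr α̇ ↔ ū^{α̇}` (`α, α̇ ∈ Fin 2`, 0 ↔ 1, 1 ↔ 2).
* The exterior algebra Λ on the four anticommuting generators `e^{αα̇}` is modelled
  concretely: `WSp = Finset (Fin 2 × Fin 2) → Pu` records the `Pu`-coefficient of each
  exterior monomial `e^{g₁} ∧ e^{g₂} ∧ …` (indexed by the subset `{g₁ < g₂ < …}` of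
  generators in a fixed order); left multiplication by a generator carries the usual
  Koszul sign.  `FormDeg k F` says that `F ∈ Λ^k ⊗ Pu`.
* A `(λ_h, λ_v)`-family of k-forms `ω = Σ ω_{n,m,r,l} χ^r t^l` is modelled by the
  function `(n,m,r,l) ↦ ω_{n,m,r,l}`, i.e. an element of `Fam = ℕ → ℕ → ℕ → ℕ → WSp`;
  `IsFam k λ_h λ_v ω` states the support, form-degree and bihomogeneity conditions.
* `sigmaM` is the operator σ₋, written slot-wise.
-/

noncomputable section

open MvPolynomial

/-- Index type of the variables `u¹,u²,ū¹,ū²`. -/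
abbrev UVar : Type := Fin 2 ⊕ Fin 2

/-- The polynomial ring `ℂ[u¹,u²,ū¹,ū²]`. -/
abbrev Pu : Type := MvPolynomial UVar ℂ

/-- The variable `u^α`. -/
def uvv (a : Fin 2) : Pu := X (Sum.inl a)

/-- The variable `ū^{α̇}`. -/
def ubvv (a : Fin 2) : Pu := X (Sum.inr a)

/-- Lowered variables `u_1 = −u²`, `u_2 = u¹`. -/
def ulow : Fin 2 → Pu := ![-(uvv 1), uvv 0]

/-- Lowered variables `ū_1 = −ū²`, `ū_2 = ū¹`. -/
def ublow : Fin 2 → Pu := ![-(ubvv 1), ubvv 0]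

/-- Index of the exterior generators `e^{αα̇}`. -/
abbrev GIdx : Type := Fin 2 × Fin 2

/-- The model of `Λ ⊗ ℂ[u,ū]`: the coefficient of each exterior monomial. -/
abbrev WSp : Type := Finset GIdx → Pu

/-- A fixed enumeration of the generators. -/
def genc (g : GIdx) : ℕ := 2 * (g.1 : ℕ) + (g.2 : ℕ)

/-- The Koszul sign picked up when wedging `e^g` onto the exterior monomial `S`. -/
def sgn (g : GIdx) (S : Finset GIdx) : ℂ :=
  (-1 : ℂ) ^ (S.filter fun g' => genc g' < genc g).card

/-- Left exterior multiplication by the generator `e^g`. -/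
def eOp (g : GIdx) : Module.End ℂ WSp where
  toFun F := fun S => if g ∈ S then sgn g S • F (S.erase g) else 0
  map_add' F G := by
    funext S
    by_cases h : g ∈ S <;> simp [h, smul_add]
  map_smul' c F := by
    funext S
    by_cases h : g ∈ S <;> simp [h, smul_smul, mul_comm]

/-- A linear operation on coefficients, applied componentwise. -/
def cMap (f : Pu →ₗ[ℂ] Pu) : Module.End ℂ WSp where
  toFun F := fun S => f (F S)
  map_add' F G := by funext S; simp
  map_smul' c F := by funext S; simp

/-- `∂/∂u^α` on coefficients. -/
def dU (a : Fin 2) : Module.End ℂ WSp := cMap (pderiv (Sum.inl a)).toLinearMap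

/-- `∂/∂ū^{α̇}` on coefficients. -/
def dUb (a : Fin 2) : Module.End ℂ WSp := cMap (pderiv (Sum.inr a)).toLinearMap

/-- Multiplication of the coefficients by a polynomial. -/
def mU (p : Pu) : Module.End ℂ WSp := cMap (LinearMap.mulLeft ℂ p)

/-- `e(u,ū) = Σ e^{αα̇} u_α ū_{α̇}`. -/
def eUU : Module.End ℂ WSp := ∑ a, ∑ b, eOp (a, b) * mU (ulow a * ublow b)

/-- `e(∂,ū) = Σ e^{αα̇} ū_{α̇} ∂/∂u^α`. -/
def eDU : Module.End ℂ WSp := ∑ a, ∑ b, eOp (a, b) * mU (ublow b) * dU a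

/-- `e(u,∂̄) = Σ e^{αα̇} u_α ∂/∂ū^{α̇}`. -/
def eUD : Module.End ℂ WSp := ∑ a, ∑ b, eOp (a, b) * mU (ulow a) * dUb b

/-- `e(∂,∂̄) = Σ e^{αα̇} ∂²/∂u^α∂ū^{α̇}`. -/
def eDD : Module.End ℂ WSp := ∑ a, ∑ b, eOp (a, b) * dU a * dUb b

/-- The basis two-form `H^{αβ} = e^{α1}∧e^{β2} − e^{α2}∧e^{β1}` (as left multiplication). -/
def Hw (a b : Fin 2) : Module.End ℂ WSp := eOp (a, 0) * eOp (b, 1) - eOp (a, 1) * eOp (b, 0)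

/-- The basis two-form `H̄^{α̇β̇} = e^{1α̇}∧e^{2β̇} − e^{2α̇}∧e^{1β̇}`. -/
def Hbw (a b : Fin 2) : Module.End ℂ WSp := eOp (0, a) * eOp (1, b) - eOp (1, a) * eOp (0, b)

/-- `H(∂,∂) = Σ H^{αβ} ∂²/∂u^α∂u^β`. -/
def HDD : Module.End ℂ WSp := ∑ a, ∑ b, Hw a b * (dU a * dU b)

/-- `H(u,u) = Σ H^{αβ} u_α u_β`. -/
def HUU : Module.End ℂ WSp := ∑ a, ∑ b, Hw a b * mU (ulow a * ulow b)

/-- `H(u,∂) = Σ H^{αβ} u_α ∂/∂u^β`. -/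
def HUD : Module.End ℂ WSp := ∑ a, ∑ b, Hw a b * (mU (ulow a) * dU b)

/-- `H̄(∂̄,∂̄) = Σ H̄^{α̇β̇} ∂²/∂ū^{α̇}∂ū^{β̇}`. -/
def HbDD : Module.End ℂ WSp := ∑ a, ∑ b, Hbw a b * (dUb a * dUb b)

/-- `H̄(ū,ū) = Σ H̄^{α̇β̇} ū_{α̇} ū_{β̇}`. -/
def HbUU : Module.End ℂ WSp := ∑ a, ∑ b, Hbw a b * mU (ublow a * ublow b)

/-- `H̄(ū,∂̄) = Σ H̄^{α̇β̇} ū_{α̇} ∂/∂ū^{β̇}`. -/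
def HbUD : Module.End ℂ WSp := ∑ a, ∑ b, Hbw a b * (mU (ublow a) * dUb b)

/-- Weight function: degree in `(u¹,u²)`. -/
def wtU : UVar → ℕ := Sum.elim (fun _ => 1) (fun _ => 0)

/-- Weight function: degree in `(ū¹,ū²)`. -/
def wtUb : UVar → ℕ := Sum.elim (fun _ => 0) (fun _ => 1)

/-- `F` is bihomogeneous of bidegree `(A,B)` (in each exterior component). -/
def Bihom (A B : ℕ) (F : WSp) : Prop :=
  ∀ S, (F S).IsWeightedHomogeneous wtU A ∧ (F S).IsWeightedHomogeneous wtUb B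

/-- `F` lies in `Λ^k ⊗ Pu`. -/
def FormDeg (k : ℕ) (F : WSp) : Prop := ∀ S, S.card ≠ k → F S = 0

/-- A family `(n,m,r,l) ↦ ω_{n,m,r,l}` of components. -/
abbrev Fam : Type := ℕ → ℕ → ℕ → ℕ → WSp

/-- `ω` is a `(λ_h,λ_v)`-family of k-forms: every component is a k-form, bihomogeneous
of bidegree `(n+r, m+r)`, and supported on slots with `n+m = λ_h`, `2(r+l) = λ_v`. -/
def IsFam (k lh lv : ℕ) (ω : Fam) : Prop :=
  ∀ n m r l : ℕ,
    FormDeg k (ω n m r l) ∧ Bihom (n + r) (m + r) (ω n m r l) ∧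
      (¬(n + m = lh ∧ 2 * (r + l) = lv) → ω n m r l = 0)

/-- The operator σ₋, written slot-wise: the slot `(n,m,r,l)` of `σ₋ω` receives
* `[n' > m']·(n'(m'+r+l+2)/((n'+r+1)(m'+r+1))) e(∂,ū) ω_{n',m',r,l}` from `(n',m') = (n+1,m−1)`,
* `[m' > n']·(m'(n'+r+l+2)/((n'+r+1)(m'+r+1))) e(u,∂̄) ω_{n',m',r,l}` from `(n',m') = (n−1,m+1)`,
* `−((r+1)(n+m+r+2)/((n+r+2)(m+r+2))) e(∂,∂̄) ω_{n,m,r+1,l−1}` (for `l ≥ 1`). -/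
def sigmaM (ω : Fam) : Fam := fun n m r l =>
  (if 1 ≤ m ∧ m - 1 < n + 1 then
      ((((n + 1) * ((m - 1) + r + l + 2) : ℕ) : ℂ) /
          ((((n + 1) + r + 1) * ((m - 1) + r + 1) : ℕ) : ℂ)) •
        eDU (ω (n + 1) (m - 1) r l)
    else 0) +
  (if 1 ≤ n ∧ n - 1 < m + 1 then
      ((((m + 1) * ((n - 1) + r + l + 2) : ℕ) : ℂ) /
          ((((n - 1) + r + 1) * ((m + 1) + r + 1) : ℕ) : ℂ)) •
        eUD (ω (n - 1) (m + 1) r l)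
    else 0) +
  (if 1 ≤ l then
      (-((((r + 1) * (n + m + (r + 1) + 1) : ℕ) : ℂ)) /
          (((n + (r + 1) + 1) * (m + (r + 1) + 1) : ℕ) : ℂ)) •
        eDD (ω n m (r + 1) (l - 1))
    else 0)

/-- The family `F χ^r t^l` concentrated in the single slot `(n,m,r,l)`. -/
def singleSlot (n m r l : ℕ) (F : WSp) : Fam := fun n' m' r' l' =>
  if n' = n ∧ m' = m ∧ r' = r ∧ l' = l then F else 0

/-- The generators of the subspace `C¹` representing `H¹(σ₋)`:
(i)  `e(∂,∂̄)(G₁) χ^{λ_v/2}` with `G₁` of bidegree `((λ_h+λ_v)/2+1, (λ_h+λ_v)/2+1)`;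
(ii) `e(u,ū)(G₂) t^{λ_v/2}` with `G₂` of bidegree `(λ_h/2−1, λ_h/2−1)` (only for λ_h ≥ 2);
(iii) `(e(u,ū) χ t^{λ_v/2−1} + (λ_h/(λ_h+λ_v+2))(e(∂,ū)+e(u,∂̄)) t^{λ_v/2})(G₃)` with
`G₃` of bidegree `(λ_h/2, λ_h/2)` (only for λ_v ≥ 2). -/
def C1set (lh lv : ℕ) : Set Fam :=
  {x | ∃ G : WSp, FormDeg 0 G ∧
        Bihom ((lh + lv) / 2 + 1) ((lh + lv) / 2 + 1) G ∧
        x = singleSlot (lh / 2) (lh / 2) (lv / 2) 0 (eDD G)} ∪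
  {x | 2 ≤ lh ∧ ∃ G : WSp, FormDeg 0 G ∧
        Bihom (lh / 2 - 1) (lh / 2 - 1) G ∧
        x = singleSlot (lh / 2) (lh / 2) 0 (lv / 2) (eUU G)} ∪
  {x | 2 ≤ lv ∧ ∃ G : WSp, FormDeg 0 G ∧
        Bihom (lh / 2) (lh / 2) G ∧
        x = singleSlot (lh / 2) (lh / 2) 1 (lv / 2 - 1) (eUU G) +
          ((lh : ℂ) / ((lh : ℂ) + (lv : ℂ) + 2)) •
            (singleSlot (lh / 2 - 1) (lh / 2 + 1) 0 (lv / 2) (eDU G) +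
              singleSlot (lh / 2 + 1) (lh / 2 - 1) 0 (lv / 2) (eUD G))}

/-- The subspace `C¹`. -/
def C1 (lh lv : ℕ) : Submodule ℂ Fam := Submodule.span ℂ (C1set lh lv)

/-! ### Derivations, variables and Euler identities -/

/-- `∂/∂u^a` as a derivation. -/
def Dx (a : Fin 2) : Derivation ℂ Pu Pu := pderiv (Sum.inl a)

/-- `∂/∂ū^a` as a derivation. -/
def Dy (a : Fin 2) : Derivation ℂ Pu Pu := pderiv (Sum.inr a)

theorem pderiv_swap (i j : UVar) (p : Pu) : pderiv i (pderiv j p) = pderiv j (pderiv i p) := by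
  have h : ⁅(pderiv i : Derivation ℂ Pu Pu), (pderiv j : Derivation ℂ Pu Pu)⁆ = 0 := by
    apply MvPolynomial.derivation_ext
    intro k
    rw [Derivation.commutator_apply]
    classical
    simp only [pderiv_X, Pi.single_apply]
    split_ifs <;> simp
  have := congrArg (fun d => d p) h
  simp only [Derivation.commutator_apply, Derivation.coe_zero, Pi.zero_apply] at this
  exact sub_eq_zero.mp this

theorem Dx_x (a b : Fin 2) : Dx a (uvv b) = if a = b then 1 else 0 := by
  classical
  simp [Dx, uvv, pderiv_X, Pi.single_apply, eq_comm]

theorem Dx_y (a b : Fin 2) : Dx a (ubvv b) = 0 := by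
  simp [Dx, ubvv]

theorem Dy_y (a b : Fin 2) : Dy a (ubvv b) = if a = b then 1 else 0 := by
  classical
  simp [Dy, ubvv, pderiv_X, Pi.single_apply, eq_comm]

theorem Dy_x (a b : Fin 2) : Dy a (uvv b) = 0 := by
  simp [Dy, uvv]

theorem Dx10 (p : Pu) : Dx 1 (Dx 0 p) = Dx 0 (Dx 1 p) := pderiv_swap _ _ _
theorem Dy10 (p : Pu) : Dy 1 (Dy 0 p) = Dy 0 (Dy 1 p) := pderiv_swap _ _ _
theorem Dyx (a b : Fin 2) (p : Pu) : Dy a (Dx b p) = Dx b (Dy a p) := pderiv_swap _ _ _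

theorem D_mul (d : Derivation ℂ Pu Pu) (p q : Pu) : d (p * q) = p * d q + q * d p := by
  simp [Derivation.leibniz]

theorem D_nat (d : Derivation ℂ Pu Pu) (n : ℕ) : d (n : Pu) = 0 := by simp

theorem D_two (d : Derivation ℂ Pu Pu) : d (2 : Pu) = 0 := by
  exact_mod_cast D_nat d 2

/-- Bihomogeneity of a single polynomial. -/
def BH (A B : ℕ) (p : Pu) : Prop :=
  p.IsWeightedHomogeneous wtU A ∧ p.IsWeightedHomogeneous wtUb B

theorem BH.zero (A B : ℕ) : BH A B 0 :=
  ⟨isWeightedHomogeneous_zero _ _ _, isWeightedHomogeneous_zero _ _ _⟩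

theorem BH.add {A B : ℕ} {p q : Pu} (hp : BH A B p) (hq : BH A B q) : BH A B (p + q) :=
  ⟨hp.1.add hq.1, hp.2.add hq.2⟩

theorem BH.sub {A B : ℕ} {p q : Pu} (hp : BH A B p) (hq : BH A B q) : BH A B (p - q) :=
  ⟨hp.1.sub hq.1, hp.2.sub hq.2⟩

theorem BH.neg {A B : ℕ} {p : Pu} (hp : BH A B p) : BH A B (-p) :=
  ⟨hp.1.neg, hp.2.neg⟩

theorem BH.smul {A B : ℕ} {p : Pu} (c : ℂ) (hp : BH A B p) : BH A B (c • p) := by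
  rw [smul_eq_C_mul]
  exact ⟨hp.1.C_mul c, hp.2.C_mul c⟩

theorem BH.xmul {A B : ℕ} {p : Pu} (a : Fin 2) (hp : BH A B p) : BH (A + 1) B (uvv a * p) := by
  have h1 := (isWeightedHomogeneous_X ℂ wtU (Sum.inl a)).mul hp.1
  have h2 := (isWeightedHomogeneous_X ℂ wtUb (Sum.inl a)).mul hp.2
  simp only [wtU, wtUb, Sum.elim_inl] at h1 h2
  rw [add_comm] at h1
  rw [zero_add] at h2
  exact ⟨h1, h2⟩

theorem BH.ymul {A B : ℕ} {p : Pu} (a : Fin 2) (hp : BH A B p) : BH A (B + 1) (ubvv a * p) := by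
  have h1 := (isWeightedHomogeneous_X ℂ wtU (Sum.inr a)).mul hp.1
  have h2 := (isWeightedHomogeneous_X ℂ wtUb (Sum.inr a)).mul hp.2
  simp only [wtU, wtUb, Sum.elim_inr] at h1 h2
  rw [zero_add] at h1
  rw [add_comm] at h2
  exact ⟨h1, h2⟩

theorem wh_pderiv_zero {w : UVar → ℕ} {i : UVar} {p : Pu} (h : p.IsWeightedHomogeneous w 0)
    (hi : w i ≠ 0) : pderiv i p = 0 := by
  apply pderiv_eq_zero_of_notMem_vars
  intro hv
  rw [mem_vars_iff_mem_support] at hv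
  obtain ⟨d, hd, hid⟩ := hv
  have h1 := h (mem_support_iff.mp hd)
  rw [Finsupp.weight_apply, Finsupp.sum, Finset.sum_eq_zero_iff] at h1
  have := h1 i hid
  simp only [smul_eq_mul, mul_eq_zero] at this
  rcases this with h3 | h3
  · exact (Finsupp.mem_support_iff.mp hid) h3
  · exact hi h3

theorem Dx_zero {B : ℕ} {p : Pu} (a : Fin 2) (hp : BH 0 B p) : Dx a p = 0 :=
  wh_pderiv_zero hp.1 (by simp [wtU])

theorem Dy_zero {A : ℕ} {p : Pu} (a : Fin 2) (hp : BH A 0 p) : Dy a p = 0 :=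
  wh_pderiv_zero hp.2 (by simp [wtUb])

theorem BH.dx {A B : ℕ} {p : Pu} (a : Fin 2) (hp : BH A B p) : BH (A - 1) B (Dx a p) := by
  rcases A with _ | A
  · rw [Dx_zero a hp]
    exact BH.zero _ _
  · exact ⟨hp.1.pderiv rfl, hp.2.pderiv rfl⟩

theorem BH.dy {A B : ℕ} {p : Pu} (a : Fin 2) (hp : BH A B p) : BH A (B - 1) (Dy a p) := by
  rcases B with _ | B
  · rw [Dy_zero a hp]
    exact BH.zero _ _
  · exact ⟨hp.1.pderiv rfl, hp.2.pderiv rfl⟩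

/-- Euler identities. -/
theorem BH.eulx {A B : ℕ} {p : Pu} (hp : BH A B p) :
    uvv 0 * Dx 0 p + uvv 1 * Dx 1 p = (A : Pu) * p := by
  have h := hp.1.sum_weight_X_mul_pderiv
  simpa [wtU, uvv, Dx, Fintype.sum_sum_type, Fin.sum_univ_two, nsmul_eq_mul] using h

theorem BH.euly {A B : ℕ} {p : Pu} (hp : BH A B p) :
    ubvv 0 * Dy 0 p + ubvv 1 * Dy 1 p = (B : Pu) * p := by
  have h := hp.2.sum_weight_X_mul_pderiv
  simpa [wtUb, ubvv, Dy, Fintype.sum_sum_type, Fin.sum_univ_two, nsmul_eq_mul] using h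

/-! ### One-form operators -/

/-- A general one-form operator with coefficients `X g`. -/
def eGen (X : GIdx → Pu →ₗ[ℂ] Pu) : Module.End ℂ WSp := ∑ g, eOp g * cMap (X g)

theorem eGen_apply (X : GIdx → Pu →ₗ[ℂ] Pu) (F : WSp) (S : Finset GIdx) :
    eGen X F S = ∑ g, if g ∈ S then sgn g S • X g (F (S.erase g)) else 0 := by
  simp only [eGen, LinearMap.sum_apply, Finset.sum_apply, Module.End.mul_apply]
  rfl

theorem eGen_single (X : GIdx → Pu →ₗ[ℂ] Pu) (F : WSp) (g : GIdx) :
    eGen X F {g} = X g (F ∅) := by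
  rw [eGen_apply, Finset.sum_eq_single g]
  · have : ({g} : Finset GIdx).filter (fun g' => genc g' < genc g) = ∅ := by
      ext a; simp only [Finset.mem_filter, Finset.mem_singleton, Finset.notMem_empty, iff_false]
      rintro ⟨rfl, h⟩; omega
    simp [sgn, this]
  · intro b _ hb; simp [hb]
  · simp

theorem eGen_pair (X : GIdx → Pu →ₗ[ℂ] Pu) (F : WSp) {g h : GIdx} (hgh : genc g < genc h) :
    eGen X F {g, h} = X g (F {h}) - X h (F {g}) := by
  have hne : g ≠ h := by rintro rfl; omega
  have e1 : ({g, h} : Finset GIdx).filter (fun g' => genc g' < genc g) = ∅ := by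
    ext a; simp only [Finset.mem_filter, Finset.mem_insert, Finset.mem_singleton,
      Finset.notMem_empty, iff_false]
    rintro ⟨rfl | rfl, h⟩ <;> omega
  have e2 : ({g, h} : Finset GIdx).filter (fun g' => genc g' < genc h) = {g} := by
    ext a; simp only [Finset.mem_filter, Finset.mem_insert, Finset.mem_singleton]
    constructor
    · rintro ⟨rfl | rfl, h⟩
      · rfl
      · omega
    · rintro rfl; exact ⟨Or.inl rfl, hgh⟩
  have e3 : ({g, h} : Finset GIdx).erase g = {h} := by
    ext a; simp only [Finset.mem_erase, Finset.mem_insert, Finset.mem_singleton]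
    constructor
    · rintro ⟨h1, h2 | h2⟩
      · exact absurd h2 h1
      · exact h2
    · rintro rfl; exact ⟨hne.symm, Or.inr rfl⟩
  have e4 : ({g, h} : Finset GIdx).erase h = {g} := by
    ext a; simp only [Finset.mem_erase, Finset.mem_insert, Finset.mem_singleton]
    constructor
    · rintro ⟨h1, h2 | h2⟩
      · exact h2
      · exact absurd h2 h1
    · rintro rfl; exact ⟨hne, Or.inl rfl⟩
  rw [eGen_apply, Finset.sum_eq_add g h hne]
  · rw [e3, e4]
    simp [sgn, e1, e2]
    rw [sub_eq_add_neg]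
  · rintro c _ ⟨h1, h2⟩
    simp [h1, h2]
  · simp
  · simp

theorem eGen_formDeg (X : GIdx → Pu →ₗ[ℂ] Pu) {F : WSp} {k : ℕ} (hF : FormDeg k F) :
    FormDeg (k + 1) (eGen X F) := by
  intro S hS
  rw [eGen_apply]
  apply Finset.sum_eq_zero
  intro g _
  split_ifs with hg
  · rw [hF (S.erase g), map_zero, smul_zero]
    rw [Finset.card_erase_of_mem hg]
    have := Finset.card_pos.mpr ⟨g, hg⟩
    omega
  · rfl

theorem eGen_bihom (X : GIdx → Pu →ₗ[ℂ] Pu) {F : WSp} {A B A' B' : ℕ}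
    (hX : ∀ g p, BH A B p → BH A' B' (X g p)) (hF : Bihom A B F) :
    Bihom A' B' (eGen X F) := by
  intro S
  change BH A' B' _
  rw [eGen_apply]
  have : ∀ g ∈ (Finset.univ : Finset GIdx),
      BH A' B' (if g ∈ S then sgn g S • X g (F (S.erase g)) else 0) := by
    intro g _
    split_ifs
    · exact BH.smul _ (hX _ _ (hF _))
    · exact BH.zero _ _
  exact ⟨IsWeightedHomogeneous.sum _ _ _ fun g hg => (this g hg).1,
    IsWeightedHomogeneous.sum _ _ _ fun g hg => (this g hg).2⟩

/-- Coefficient operators. -/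
def XUU (g : GIdx) : Pu →ₗ[ℂ] Pu := LinearMap.mulLeft ℂ (ulow g.1 * ublow g.2)
def XDU (g : GIdx) : Pu →ₗ[ℂ] Pu := (LinearMap.mulLeft ℂ (ublow g.2)) ∘ₗ (Dx g.1).toLinearMap
def XUD (g : GIdx) : Pu →ₗ[ℂ] Pu := (LinearMap.mulLeft ℂ (ulow g.1)) ∘ₗ (Dy g.2).toLinearMap
def XDD (g : GIdx) : Pu →ₗ[ℂ] Pu := (Dx g.1).toLinearMap ∘ₗ (Dy g.2).toLinearMap

theorem XUU_apply (g : GIdx) (p : Pu) : XUU g p = ulow g.1 * ublow g.2 * p := rfl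
theorem XDU_apply (g : GIdx) (p : Pu) : XDU g p = ublow g.2 * Dx g.1 p := rfl
theorem XUD_apply (g : GIdx) (p : Pu) : XUD g p = ulow g.1 * Dy g.2 p := rfl
theorem XDD_apply (g : GIdx) (p : Pu) : XDD g p = Dx g.1 (Dy g.2 p) := rfl

theorem cMap_mul (f g : Pu →ₗ[ℂ] Pu) : cMap f * cMap g = cMap (f ∘ₗ g) := rfl

theorem eUU_eq : eUU = eGen XUU := by
  simp only [eUU, eGen, Fintype.sum_prod_type, mul_assoc, mU, dU, dUb, cMap_mul, XUU, Dx, Dy]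
theorem eDU_eq : eDU = eGen XDU := by
  simp only [eDU, eGen, Fintype.sum_prod_type, mul_assoc, mU, dU, dUb, cMap_mul, XDU, Dx, Dy]
theorem eUD_eq : eUD = eGen XUD := by
  simp only [eUD, eGen, Fintype.sum_prod_type, mul_assoc, mU, dU, dUb, cMap_mul, XUD, Dx, Dy]
theorem eDD_eq : eDD = eGen XDD := by
  simp only [eDD, eGen, Fintype.sum_prod_type, mul_assoc, mU, dU, dUb, cMap_mul, XDD, Dx, Dy]

theorem ulow0 : ulow 0 = -(uvv 1) := rfl
theorem ulow1 : ulow 1 = uvv 0 := rfl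
theorem ublow0 : ublow 0 = -(ubvv 1) := rfl
theorem ublow1 : ublow 1 = ubvv 0 := rfl

theorem BH.ulmul {A B : ℕ} {p : Pu} (a : Fin 2) (hp : BH A B p) : BH (A + 1) B (ulow a * p) := by
  fin_cases a
  · simp only [Fin.zero_eta, ulow0, neg_mul]; exact (hp.xmul 1).neg
  · simp only [Fin.mk_one, ulow1]; exact hp.xmul 0

theorem BH.ublmul {A B : ℕ} {p : Pu} (a : Fin 2) (hp : BH A B p) :
    BH A (B + 1) (ublow a * p) := by
  fin_cases a
  · simp only [Fin.zero_eta, ublow0, neg_mul]; exact (hp.ymul 1).neg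
  · simp only [Fin.mk_one, ublow1]; exact hp.ymul 0

theorem eUU_bihom {A B : ℕ} {F : WSp} (hF : Bihom A B F) : Bihom (A + 1) (B + 1) (eUU F) := by
  rw [eUU_eq]
  refine eGen_bihom _ (fun g p hp => ?_) hF
  rw [XUU_apply, mul_assoc]
  exact (hp.ublmul _).ulmul _
theorem eDU_bihom {A B : ℕ} {F : WSp} (hF : Bihom A B F) : Bihom (A - 1) (B + 1) (eDU F) := by
  rw [eDU_eq]
  refine eGen_bihom _ (fun g p hp => ?_) hF
  rw [XDU_apply]
  exact (hp.dx _).ublmul _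
theorem eUD_bihom {A B : ℕ} {F : WSp} (hF : Bihom A B F) : Bihom (A + 1) (B - 1) (eUD F) := by
  rw [eUD_eq]
  refine eGen_bihom _ (fun g p hp => ?_) hF
  rw [XUD_apply]
  exact (hp.dy _).ulmul _
theorem eDD_bihom {A B : ℕ} {F : WSp} (hF : Bihom A B F) : Bihom (A - 1) (B - 1) (eDD F) := by
  rw [eDD_eq]
  refine eGen_bihom _ (fun g p hp => ?_) hF
  rw [XDD_apply]
  exact (hp.dy _).dx _


set_option linter.unusedSimpArgs false
theorem BH.ex0 {A B : ℕ} {p : Pu} (hp : BH A B p) :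
    uvv 0 * Dx 0 (Dx 0 p) + uvv 1 * Dx 0 (Dx 1 p) = ((A : Pu) - 1) * Dx 0 p := by
  have h := congrArg (Dx 0) hp.eulx
  simp [D_mul, Dx_x, D_nat] at h
  linear_combination h

theorem BH.ex1 {A B : ℕ} {p : Pu} (hp : BH A B p) :
    uvv 0 * Dx 0 (Dx 1 p) + uvv 1 * Dx 1 (Dx 1 p) = ((A : Pu) - 1) * Dx 1 p := by
  have h := congrArg (Dx 1) hp.eulx
  simp [D_mul, Dx_x, D_nat, Dx10] at h
  linear_combination h

theorem BH.ey0 {A B : ℕ} {p : Pu} (hp : BH A B p) :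
    ubvv 0 * Dy 0 (Dy 0 p) + ubvv 1 * Dy 0 (Dy 1 p) = ((B : Pu) - 1) * Dy 0 p := by
  have h := congrArg (Dy 0) hp.euly
  simp [D_mul, Dy_y, D_nat] at h
  linear_combination h

theorem BH.ey1 {A B : ℕ} {p : Pu} (hp : BH A B p) :
    ubvv 0 * Dy 0 (Dy 1 p) + ubvv 1 * Dy 1 (Dy 1 p) = ((B : Pu) - 1) * Dy 1 p := by
  have h := congrArg (Dy 1) hp.euly
  simp [D_mul, Dy_y, D_nat, Dy10] at h
  linear_combination h

theorem BH.eyd {A B : ℕ} {p : Pu} (hp : BH A B p) (a : Fin 2) :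
    ubvv 0 * Dx a (Dy 0 p) + ubvv 1 * Dx a (Dy 1 p) = (B : Pu) * Dx a p := by
  have h := (hp.dx a).euly
  simpa only [Dyx] using h

theorem BH.ey0d {A B : ℕ} {p : Pu} (hp : BH A B p) (a : Fin 2) :
    ubvv 0 * Dx a (Dy 0 (Dy 0 p)) + ubvv 1 * Dx a (Dy 0 (Dy 1 p))
      = ((B : Pu) - 1) * Dx a (Dy 0 p) := by
  have h := (hp.dx a).ey0
  simpa only [Dyx] using h

theorem BH.ey1d {A B : ℕ} {p : Pu} (hp : BH A B p) (a : Fin 2) :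
    ubvv 0 * Dx a (Dy 0 (Dy 1 p)) + ubvv 1 * Dx a (Dy 1 (Dy 1 p))
      = ((B : Pu) - 1) * Dx a (Dy 1 p) := by
  have h := (hp.dx a).ey1
  simpa only [Dyx] using h

theorem smulC (c : ℂ) (p : Pu) : c • p = C c * p := smul_eq_C_mul p c

theorem eUU_single (F : WSp) (g : GIdx) : eUU F {g} = XUU g (F ∅) := by rw [eUU_eq, eGen_single]
theorem eDU_single (F : WSp) (g : GIdx) : eDU F {g} = XDU g (F ∅) := by rw [eDU_eq, eGen_single]
theorem eUD_single (F : WSp) (g : GIdx) : eUD F {g} = XUD g (F ∅) := by rw [eUD_eq, eGen_single]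
theorem eDD_single (F : WSp) (g : GIdx) : eDD F {g} = XDD g (F ∅) := by rw [eDD_eq, eGen_single]

theorem eDU_pair (F : WSp) {g h : GIdx} (hgh : genc g < genc h) :
    eDU F {g, h} = XDU g (F {h}) - XDU h (F {g}) := by rw [eDU_eq, eGen_pair _ _ hgh]
theorem eUD_pair (F : WSp) {g h : GIdx} (hgh : genc g < genc h) :
    eUD F {g, h} = XUD g (F {h}) - XUD h (F {g}) := by rw [eUD_eq, eGen_pair _ _ hgh]
theorem eDD_pair (F : WSp) {g h : GIdx} (hgh : genc g < genc h) :
    eDD F {g, h} = XDD g (F {h}) - XDD h (F {g}) := by rw [eDD_eq, eGen_pair _ _ hgh]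

theorem lt1 : genc (0, 0) < genc (0, 1) := by decide
theorem lt2 : genc (0, 0) < genc (1, 0) := by decide
theorem lt3 : genc (0, 0) < genc (1, 1) := by decide
theorem lt4 : genc (0, 1) < genc (1, 0) := by decide
theorem lt5 : genc (0, 1) < genc (1, 1) := by decide
theorem lt6 : genc (1, 0) < genc (1, 1) := by decide

/-! ### Projections of one-forms -/

/-- Projection `pd`. -/
def pd : WSp →ₗ[ℂ] Pu where
  toFun F := uvv 0 * ubvv 0 * F {(0, 0)} + uvv 0 * ubvv 1 * F {(0, 1)} + uvv 1 * ubvv 0 * F {(1, 0)} +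
    uvv 1 * ubvv 1 * F {(1, 1)}
  map_add' F G := by
    simp only [Pi.add_apply, D_mul, D_two, map_add, map_sub, mul_zero, add_zero]
    ring
  map_smul' c F := by
    simp only [Pi.smul_apply, Derivation.map_smul, map_sub, map_add, D_mul, D_two,
      mul_zero, add_zero, RingHom.id_apply]
    simp only [smulC]
    ring

theorem pd_apply (F : WSp) : pd F = uvv 0 * ubvv 0 * F {(0, 0)} + uvv 0 * ubvv 1 * F {(0, 1)} + uvv 1 * ubvv 0 * F {(1, 0)} +
    uvv 1 * ubvv 1 * F {(1, 1)} := rfl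

/-- Projection `pb`. -/
def pb : WSp →ₗ[ℂ] Pu where
  toFun F := uvv 0 * (Dy 1 (F {(0, 0)}) - Dy 0 (F {(0, 1)})) + uvv 1 * (Dy 1 (F {(1, 0)}) - Dy 0 (F {(1, 1)}))
  map_add' F G := by
    simp only [Pi.add_apply, D_mul, D_two, map_add, map_sub, mul_zero, add_zero]
    ring
  map_smul' c F := by
    simp only [Pi.smul_apply, Derivation.map_smul, map_sub, map_add, D_mul, D_two,
      mul_zero, add_zero, RingHom.id_apply]
    simp only [smulC]
    ring

theorem pb_apply (F : WSp) : pb F = uvv 0 * (Dy 1 (F {(0, 0)}) - Dy 0 (F {(0, 1)})) + uvv 1 * (Dy 1 (F {(1, 0)}) - Dy 0 (F {(1, 1)})) := rfl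

/-- Projection `pc`. -/
def pc : WSp →ₗ[ℂ] Pu where
  toFun F := ubvv 0 * (Dx 1 (F {(0, 0)}) - Dx 0 (F {(1, 0)})) + ubvv 1 * (Dx 1 (F {(0, 1)}) - Dx 0 (F {(1, 1)}))
  map_add' F G := by
    simp only [Pi.add_apply, D_mul, D_two, map_add, map_sub, mul_zero, add_zero]
    ring
  map_smul' c F := by
    simp only [Pi.smul_apply, Derivation.map_smul, map_sub, map_add, D_mul, D_two,
      mul_zero, add_zero, RingHom.id_apply]
    simp only [smulC]
    ring

theorem pc_apply (F : WSp) : pc F = ubvv 0 * (Dx 1 (F {(0, 0)}) - Dx 0 (F {(1, 0)})) + ubvv 1 * (Dx 1 (F {(0, 1)}) - Dx 0 (F {(1, 1)})) := rfl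

/-- Projection `pa`. -/
def pa : WSp →ₗ[ℂ] Pu where
  toFun F := Dx 1 (Dy 1 (F {(0, 0)})) - Dx 1 (Dy 0 (F {(0, 1)})) - Dx 0 (Dy 1 (F {(1, 0)})) +
    Dx 0 (Dy 0 (F {(1, 1)}))
  map_add' F G := by
    simp only [Pi.add_apply, D_mul, D_two, map_add, map_sub, mul_zero, add_zero]
    ring
  map_smul' c F := by
    simp only [Pi.smul_apply, Derivation.map_smul, map_sub, map_add, D_mul, D_two,
      mul_zero, add_zero, RingHom.id_apply]
    simp only [smulC]
    ring

theorem pa_apply (F : WSp) : pa F = Dx 1 (Dy 1 (F {(0, 0)})) - Dx 1 (Dy 0 (F {(0, 1)})) - Dx 0 (Dy 1 (F {(1, 0)})) +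
    Dx 0 (Dy 0 (F {(1, 1)})) := rfl

/-- Projection `q1`. -/
def q1 : WSp →ₗ[ℂ] Pu where
  toFun F := uvv 0 * uvv 0 * (2 * F {(0, 0), (0, 1)}) + 2 * (uvv 0 * uvv 1 * (F {(0, 0), (1, 1)} - F {(0, 1), (1, 0)})) +
    uvv 1 * uvv 1 * (2 * F {(1, 0), (1, 1)})
  map_add' F G := by
    simp only [Pi.add_apply, D_mul, D_two, map_add, map_sub, mul_zero, add_zero]
    ring
  map_smul' c F := by
    simp only [Pi.smul_apply, Derivation.map_smul, map_sub, map_add, D_mul, D_two,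
      mul_zero, add_zero, RingHom.id_apply]
    simp only [smulC]
    ring

theorem q1_apply (F : WSp) : q1 F = uvv 0 * uvv 0 * (2 * F {(0, 0), (0, 1)}) + 2 * (uvv 0 * uvv 1 * (F {(0, 0), (1, 1)} - F {(0, 1), (1, 0)})) +
    uvv 1 * uvv 1 * (2 * F {(1, 0), (1, 1)}) := rfl

/-- Projection `q3`. -/
def q3 : WSp →ₗ[ℂ] Pu where
  toFun F := Dx 1 (Dx 1 (2 * F {(0, 0), (0, 1)})) - 2 * Dx 0 (Dx 1 (F {(0, 0), (1, 1)} - F {(0, 1), (1, 0)})) +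
    Dx 0 (Dx 0 (2 * F {(1, 0), (1, 1)}))
  map_add' F G := by
    simp only [Pi.add_apply, D_mul, D_two, map_add, map_sub, mul_zero, add_zero]
    ring
  map_smul' c F := by
    simp only [Pi.smul_apply, Derivation.map_smul, map_sub, map_add, D_mul, D_two,
      mul_zero, add_zero, RingHom.id_apply]
    simp only [smulC]
    ring

theorem q3_apply (F : WSp) : q3 F = Dx 1 (Dx 1 (2 * F {(0, 0), (0, 1)})) - 2 * Dx 0 (Dx 1 (F {(0, 0), (1, 1)} - F {(0, 1), (1, 0)})) +
    Dx 0 (Dx 0 (2 * F {(1, 0), (1, 1)})) := rfl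

/-- Projection `q5`. -/
def q5 : WSp →ₗ[ℂ] Pu where
  toFun F := uvv 0 * Dx 1 (2 * F {(0, 0), (0, 1)}) - uvv 0 * Dx 0 (F {(0, 0), (1, 1)} - F {(0, 1), (1, 0)}) +
    uvv 1 * Dx 1 (F {(0, 0), (1, 1)} - F {(0, 1), (1, 0)}) - uvv 1 * Dx 0 (2 * F {(1, 0), (1, 1)})
  map_add' F G := by
    simp only [Pi.add_apply, D_mul, D_two, map_add, map_sub, mul_zero, add_zero]
    ring
  map_smul' c F := by
    simp only [Pi.smul_apply, Derivation.map_smul, map_sub, map_add, D_mul, D_two,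
      mul_zero, add_zero, RingHom.id_apply]
    simp only [smulC]
    ring

theorem q5_apply (F : WSp) : q5 F = uvv 0 * Dx 1 (2 * F {(0, 0), (0, 1)}) - uvv 0 * Dx 0 (F {(0, 0), (1, 1)} - F {(0, 1), (1, 0)}) +
    uvv 1 * Dx 1 (F {(0, 0), (1, 1)} - F {(0, 1), (1, 0)}) - uvv 1 * Dx 0 (2 * F {(1, 0), (1, 1)}) := rfl

/-- Projection `q2`. -/
def q2 : WSp →ₗ[ℂ] Pu where
  toFun F := ubvv 0 * ubvv 0 * (2 * F {(0, 0), (1, 0)}) + 2 * (ubvv 0 * ubvv 1 * (F {(0, 0), (1, 1)} + F {(0, 1), (1, 0)})) +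
    ubvv 1 * ubvv 1 * (2 * F {(0, 1), (1, 1)})
  map_add' F G := by
    simp only [Pi.add_apply, D_mul, D_two, map_add, map_sub, mul_zero, add_zero]
    ring
  map_smul' c F := by
    simp only [Pi.smul_apply, Derivation.map_smul, map_sub, map_add, D_mul, D_two,
      mul_zero, add_zero, RingHom.id_apply]
    simp only [smulC]
    ring

theorem q2_apply (F : WSp) : q2 F = ubvv 0 * ubvv 0 * (2 * F {(0, 0), (1, 0)}) + 2 * (ubvv 0 * ubvv 1 * (F {(0, 0), (1, 1)} + F {(0, 1), (1, 0)})) +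
    ubvv 1 * ubvv 1 * (2 * F {(0, 1), (1, 1)}) := rfl

/-- Projection `q4`. -/
def q4 : WSp →ₗ[ℂ] Pu where
  toFun F := Dy 1 (Dy 1 (2 * F {(0, 0), (1, 0)})) - 2 * Dy 0 (Dy 1 (F {(0, 0), (1, 1)} + F {(0, 1), (1, 0)})) +
    Dy 0 (Dy 0 (2 * F {(0, 1), (1, 1)}))
  map_add' F G := by
    simp only [Pi.add_apply, D_mul, D_two, map_add, map_sub, mul_zero, add_zero]
    ring
  map_smul' c F := by
    simp only [Pi.smul_apply, Derivation.map_smul, map_sub, map_add, D_mul, D_two,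
      mul_zero, add_zero, RingHom.id_apply]
    simp only [smulC]
    ring

theorem q4_apply (F : WSp) : q4 F = Dy 1 (Dy 1 (2 * F {(0, 0), (1, 0)})) - 2 * Dy 0 (Dy 1 (F {(0, 0), (1, 1)} + F {(0, 1), (1, 0)})) +
    Dy 0 (Dy 0 (2 * F {(0, 1), (1, 1)})) := rfl

/-- Projection `q6`. -/
def q6 : WSp →ₗ[ℂ] Pu where
  toFun F := ubvv 0 * Dy 1 (2 * F {(0, 0), (1, 0)}) - ubvv 0 * Dy 0 (F {(0, 0), (1, 1)} + F {(0, 1), (1, 0)}) +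
    ubvv 1 * Dy 1 (F {(0, 0), (1, 1)} + F {(0, 1), (1, 0)}) - ubvv 1 * Dy 0 (2 * F {(0, 1), (1, 1)})
  map_add' F G := by
    simp only [Pi.add_apply, D_mul, D_two, map_add, map_sub, mul_zero, add_zero]
    ring
  map_smul' c F := by
    simp only [Pi.smul_apply, Derivation.map_smul, map_sub, map_add, D_mul, D_two,
      mul_zero, add_zero, RingHom.id_apply]
    simp only [smulC]
    ring

theorem q6_apply (F : WSp) : q6 F = ubvv 0 * Dy 1 (2 * F {(0, 0), (1, 0)}) - ubvv 0 * Dy 0 (F {(0, 0), (1, 1)} + F {(0, 1), (1, 0)}) +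
    ubvv 1 * Dy 1 (F {(0, 0), (1, 1)} + F {(0, 1), (1, 0)}) - ubvv 1 * Dy 0 (2 * F {(0, 1), (1, 1)}) := rfl

theorem pa_eUU {P Q : ℕ} {F : WSp} (h : BH P Q (F ∅)) : pa (eUU F) = ((P + 2) * (Q + 2) : ℂ) • F ∅ := by
  simp only [pa_apply, eUU_single, XUU_apply, D_mul, D_two, Derivation.map_one_eq_zero, Dx_x, Dx_y, Dy_y, Dy_x, Dx10, Dy10, Dyx, map_add, map_sub, map_neg, map_mul,
    map_natCast, map_ofNat, map_one, smulC, ulow0, ulow1, ublow0, ublow1, if_true,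
    zero_ne_one, one_ne_zero, if_false, mul_zero, zero_mul, map_zero]
  linear_combination uvv 0 * h.eyd 0 + uvv 1 * h.eyd 1 + ((Q : Pu) + 2) * h.eulx + 2 * h.euly

theorem pa_eDU (F : WSp) : pa (eDU F) = 0 := by
  simp only [pa_apply, eDU_single, XDU_apply, D_mul, D_two, Derivation.map_one_eq_zero, Dx_x, Dx_y, Dy_y, Dy_x, Dx10, Dy10, Dyx, map_add, map_sub, map_neg, map_mul,
    map_natCast, map_ofNat, map_one, smulC, ulow0, ulow1, ublow0, ublow1, if_true,
    zero_ne_one, one_ne_zero, if_false, mul_zero, zero_mul, map_zero]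
  ring

theorem pa_eUD (F : WSp) : pa (eUD F) = 0 := by
  simp only [pa_apply, eUD_single, XUD_apply, D_mul, D_two, Derivation.map_one_eq_zero, Dx_x, Dx_y, Dy_y, Dy_x, Dx10, Dy10, Dyx, map_add, map_sub, map_neg, map_mul,
    map_natCast, map_ofNat, map_one, smulC, ulow0, ulow1, ublow0, ublow1, if_true,
    zero_ne_one, one_ne_zero, if_false, mul_zero, zero_mul, map_zero]
  ring

theorem pa_eDD (F : WSp) : pa (eDD F) = 0 := by
  simp only [pa_apply, eDD_single, XDD_apply, D_mul, D_two, Derivation.map_one_eq_zero, Dx_x, Dx_y, Dy_y, Dy_x, Dx10, Dy10, Dyx, map_add, map_sub, map_neg, map_mul,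
    map_natCast, map_ofNat, map_one, smulC, ulow0, ulow1, ublow0, ublow1, if_true,
    zero_ne_one, one_ne_zero, if_false, mul_zero, zero_mul, map_zero]
  ring

theorem pb_eUU (F : WSp) : pb (eUU F) = 0 := by
  simp only [pb_apply, eUU_single, XUU_apply, D_mul, D_two, Derivation.map_one_eq_zero, Dx_x, Dx_y, Dy_y, Dy_x, Dx10, Dy10, Dyx, map_add, map_sub, map_neg, map_mul,
    map_natCast, map_ofNat, map_one, smulC, ulow0, ulow1, ublow0, ublow1, if_true,
    zero_ne_one, one_ne_zero, if_false, mul_zero, zero_mul, map_zero]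
  ring

theorem pb_eDU {P Q : ℕ} {F : WSp} (h : BH P Q (F ∅)) : pb (eDU F) = (-(P * (Q + 2)) : ℂ) • F ∅ := by
  simp only [pb_apply, eDU_single, XDU_apply, D_mul, D_two, Derivation.map_one_eq_zero, Dx_x, Dx_y, Dy_y, Dy_x, Dx10, Dy10, Dyx, map_add, map_sub, map_neg, map_mul,
    map_natCast, map_ofNat, map_one, smulC, ulow0, ulow1, ublow0, ublow1, if_true,
    zero_ne_one, one_ne_zero, if_false, mul_zero, zero_mul, map_zero]
  linear_combination -(uvv 0 * h.eyd 0 + uvv 1 * h.eyd 1) - ((Q : Pu) + 2) * h.eulx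

theorem pb_eUD (F : WSp) : pb (eUD F) = 0 := by
  simp only [pb_apply, eUD_single, XUD_apply, D_mul, D_two, Derivation.map_one_eq_zero, Dx_x, Dx_y, Dy_y, Dy_x, Dx10, Dy10, Dyx, map_add, map_sub, map_neg, map_mul,
    map_natCast, map_ofNat, map_one, smulC, ulow0, ulow1, ublow0, ublow1, if_true,
    zero_ne_one, one_ne_zero, if_false, mul_zero, zero_mul, map_zero]
  ring

theorem pb_eDD (F : WSp) : pb (eDD F) = 0 := by
  simp only [pb_apply, eDD_single, XDD_apply, D_mul, D_two, Derivation.map_one_eq_zero, Dx_x, Dx_y, Dy_y, Dy_x, Dx10, Dy10, Dyx, map_add, map_sub, map_neg, map_mul,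
    map_natCast, map_ofNat, map_one, smulC, ulow0, ulow1, ublow0, ublow1, if_true,
    zero_ne_one, one_ne_zero, if_false, mul_zero, zero_mul, map_zero]
  ring

theorem pc_eUU (F : WSp) : pc (eUU F) = 0 := by
  simp only [pc_apply, eUU_single, XUU_apply, D_mul, D_two, Derivation.map_one_eq_zero, Dx_x, Dx_y, Dy_y, Dy_x, Dx10, Dy10, Dyx, map_add, map_sub, map_neg, map_mul,
    map_natCast, map_ofNat, map_one, smulC, ulow0, ulow1, ublow0, ublow1, if_true,
    zero_ne_one, one_ne_zero, if_false, mul_zero, zero_mul, map_zero]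
  ring

theorem pc_eDU (F : WSp) : pc (eDU F) = 0 := by
  simp only [pc_apply, eDU_single, XDU_apply, D_mul, D_two, Derivation.map_one_eq_zero, Dx_x, Dx_y, Dy_y, Dy_x, Dx10, Dy10, Dyx, map_add, map_sub, map_neg, map_mul,
    map_natCast, map_ofNat, map_one, smulC, ulow0, ulow1, ublow0, ublow1, if_true,
    zero_ne_one, one_ne_zero, if_false, mul_zero, zero_mul, map_zero]
  ring

theorem pc_eUD {P Q : ℕ} {F : WSp} (h : BH P Q (F ∅)) : pc (eUD F) = (-((P + 2) * Q) : ℂ) • F ∅ := by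
  simp only [pc_apply, eUD_single, XUD_apply, D_mul, D_two, Derivation.map_one_eq_zero, Dx_x, Dx_y, Dy_y, Dy_x, Dx10, Dy10, Dyx, map_add, map_sub, map_neg, map_mul,
    map_natCast, map_ofNat, map_one, smulC, ulow0, ulow1, ublow0, ublow1, if_true,
    zero_ne_one, one_ne_zero, if_false, mul_zero, zero_mul, map_zero]
  linear_combination -(ubvv 0 * (h.dy 0).eulx + ubvv 1 * (h.dy 1).eulx) - ((P : Pu) + 2) * h.euly

theorem pc_eDD (F : WSp) : pc (eDD F) = 0 := by
  simp only [pc_apply, eDD_single, XDD_apply, D_mul, D_two, Derivation.map_one_eq_zero, Dx_x, Dx_y, Dy_y, Dy_x, Dx10, Dy10, Dyx, map_add, map_sub, map_neg, map_mul,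
    map_natCast, map_ofNat, map_one, smulC, ulow0, ulow1, ublow0, ublow1, if_true,
    zero_ne_one, one_ne_zero, if_false, mul_zero, zero_mul, map_zero]
  ring

theorem pd_eUU (F : WSp) : pd (eUU F) = 0 := by
  simp only [pd_apply, eUU_single, XUU_apply, D_mul, D_two, Derivation.map_one_eq_zero, Dx_x, Dx_y, Dy_y, Dy_x, Dx10, Dy10, Dyx, map_add, map_sub, map_neg, map_mul,
    map_natCast, map_ofNat, map_one, smulC, ulow0, ulow1, ublow0, ublow1, if_true,
    zero_ne_one, one_ne_zero, if_false, mul_zero, zero_mul, map_zero]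
  ring

theorem pd_eDU (F : WSp) : pd (eDU F) = 0 := by
  simp only [pd_apply, eDU_single, XDU_apply, D_mul, D_two, Derivation.map_one_eq_zero, Dx_x, Dx_y, Dy_y, Dy_x, Dx10, Dy10, Dyx, map_add, map_sub, map_neg, map_mul,
    map_natCast, map_ofNat, map_one, smulC, ulow0, ulow1, ublow0, ublow1, if_true,
    zero_ne_one, one_ne_zero, if_false, mul_zero, zero_mul, map_zero]
  ring

theorem pd_eUD (F : WSp) : pd (eUD F) = 0 := by
  simp only [pd_apply, eUD_single, XUD_apply, D_mul, D_two, Derivation.map_one_eq_zero, Dx_x, Dx_y, Dy_y, Dy_x, Dx10, Dy10, Dyx, map_add, map_sub, map_neg, map_mul,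
    map_natCast, map_ofNat, map_one, smulC, ulow0, ulow1, ublow0, ublow1, if_true,
    zero_ne_one, one_ne_zero, if_false, mul_zero, zero_mul, map_zero]
  ring

theorem pd_eDD {P Q : ℕ} {F : WSp} (h : BH P Q (F ∅)) : pd (eDD F) = (P * Q : ℂ) • F ∅ := by
  simp only [pd_apply, eDD_single, XDD_apply, D_mul, D_two, Derivation.map_one_eq_zero, Dx_x, Dx_y, Dy_y, Dy_x, Dx10, Dy10, Dyx, map_add, map_sub, map_neg, map_mul,
    map_natCast, map_ofNat, map_one, smulC, ulow0, ulow1, ublow0, ublow1, if_true,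
    zero_ne_one, one_ne_zero, if_false, mul_zero, zero_mul, map_zero]
  linear_combination uvv 0 * h.eyd 0 + uvv 1 * h.eyd 1 + (Q : Pu) * h.eulx

theorem q1_eDU {A B : ℕ} {F : WSp} (h : ∀ g, BH A B (F {g})) : q1 (eDU F) = (-(2 * A) : ℂ) • pd F := by
  simp only [q1_apply, pd_apply, eDU_pair _ lt1, eDU_pair _ lt2, eDU_pair _ lt3, eDU_pair _ lt4,
    eDU_pair _ lt5, eDU_pair _ lt6, XDU_apply, D_mul, D_two, Derivation.map_one_eq_zero, Dx_x, Dx_y, Dy_y, Dy_x, Dx10, Dy10, Dyx, map_add, map_sub, map_neg, map_mul,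
    map_natCast, map_ofNat, map_one, smulC, ulow0, ulow1, ublow0, ublow1, if_true,
    zero_ne_one, one_ne_zero, if_false, mul_zero, zero_mul, map_zero]
  linear_combination -2 * (uvv 0 * ubvv 0 * (h (0, 0)).eulx + uvv 0 * ubvv 1 * (h (0, 1)).eulx + uvv 1 * ubvv 0 * (h (1, 0)).eulx + uvv 1 * ubvv 1 * (h (1, 1)).eulx)

theorem q1_eUD (F : WSp) : q1 (eUD F) = 0 := by
  simp only [q1_apply, eUD_pair _ lt1, eUD_pair _ lt2, eUD_pair _ lt3, eUD_pair _ lt4,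
    eUD_pair _ lt5, eUD_pair _ lt6, XUD_apply, D_mul, D_two, Derivation.map_one_eq_zero, Dx_x, Dx_y, Dy_y, Dy_x, Dx10, Dy10, Dyx, map_add, map_sub, map_neg, map_mul,
    map_natCast, map_ofNat, map_one, smulC, ulow0, ulow1, ublow0, ublow1, if_true,
    zero_ne_one, one_ne_zero, if_false, mul_zero, zero_mul, map_zero]
  ring

theorem q1_eDD {A B : ℕ} {F : WSp} (h : ∀ g, BH A B (F {g})) : q1 (eDD F) = (-(2 * A) : ℂ) • pb F := by
  simp only [q1_apply, pb_apply, eDD_pair _ lt1, eDD_pair _ lt2, eDD_pair _ lt3, eDD_pair _ lt4,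
    eDD_pair _ lt5, eDD_pair _ lt6, XDD_apply, D_mul, D_two, Derivation.map_one_eq_zero, Dx_x, Dx_y, Dy_y, Dy_x, Dx10, Dy10, Dyx, map_add, map_sub, map_neg, map_mul,
    map_natCast, map_ofNat, map_one, smulC, ulow0, ulow1, ublow0, ublow1, if_true,
    zero_ne_one, one_ne_zero, if_false, mul_zero, zero_mul, map_zero]
  linear_combination -2 * (uvv 0 * (((h (0, 0)).dy 1).eulx - ((h (0, 1)).dy 0).eulx) + uvv 1 * (((h (1, 0)).dy 1).eulx - ((h (1, 1)).dy 0).eulx))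

theorem q3_eDU (F : WSp) : q3 (eDU F) = 0 := by
  simp only [q3_apply, eDU_pair _ lt1, eDU_pair _ lt2, eDU_pair _ lt3, eDU_pair _ lt4,
    eDU_pair _ lt5, eDU_pair _ lt6, XDU_apply, D_mul, D_two, Derivation.map_one_eq_zero, Dx_x, Dx_y, Dy_y, Dy_x, Dx10, Dy10, Dyx, map_add, map_sub, map_neg, map_mul,
    map_natCast, map_ofNat, map_one, smulC, ulow0, ulow1, ublow0, ublow1, if_true,
    zero_ne_one, one_ne_zero, if_false, mul_zero, zero_mul, map_zero]
  ring

theorem q3_eUD {A B : ℕ} {F : WSp} (h : ∀ g, BH A B (F {g})) : q3 (eUD F) = (2 * (A + 2) : ℂ) • pa F := by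
  simp only [q3_apply, pa_apply, eUD_pair _ lt1, eUD_pair _ lt2, eUD_pair _ lt3, eUD_pair _ lt4,
    eUD_pair _ lt5, eUD_pair _ lt6, XUD_apply, D_mul, D_two, Derivation.map_one_eq_zero, Dx_x, Dx_y, Dy_y, Dy_x, Dx10, Dy10, Dyx, map_add, map_sub, map_neg, map_mul,
    map_natCast, map_ofNat, map_one, smulC, ulow0, ulow1, ublow0, ublow1, if_true,
    zero_ne_one, one_ne_zero, if_false, mul_zero, zero_mul, map_zero]
  linear_combination 2 * ((((h (0, 0)).dy 1).ex1 - ((h (0, 1)).dy 0).ex1) - (((h (1, 0)).dy 1).ex0 - ((h (1, 1)).dy 0).ex0))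

theorem q3_eDD (F : WSp) : q3 (eDD F) = 0 := by
  simp only [q3_apply, eDD_pair _ lt1, eDD_pair _ lt2, eDD_pair _ lt3, eDD_pair _ lt4,
    eDD_pair _ lt5, eDD_pair _ lt6, XDD_apply, D_mul, D_two, Derivation.map_one_eq_zero, Dx_x, Dx_y, Dy_y, Dy_x, Dx10, Dy10, Dyx, map_add, map_sub, map_neg, map_mul,
    map_natCast, map_ofNat, map_one, smulC, ulow0, ulow1, ublow0, ublow1, if_true,
    zero_ne_one, one_ne_zero, if_false, mul_zero, zero_mul, map_zero]
  ring

theorem q5_eDU {A B : ℕ} {F : WSp} (h : ∀ g, BH A B (F {g})) : q5 (eDU F) = (-(A - 1) : ℂ) • pc F := by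
  simp only [q5_apply, pc_apply, eDU_pair _ lt1, eDU_pair _ lt2, eDU_pair _ lt3, eDU_pair _ lt4,
    eDU_pair _ lt5, eDU_pair _ lt6, XDU_apply, D_mul, D_two, Derivation.map_one_eq_zero, Dx_x, Dx_y, Dy_y, Dy_x, Dx10, Dy10, Dyx, map_add, map_sub, map_neg, map_mul,
    map_natCast, map_ofNat, map_one, smulC, ulow0, ulow1, ublow0, ublow1, if_true,
    zero_ne_one, one_ne_zero, if_false, mul_zero, zero_mul, map_zero]
  linear_combination -(ubvv 0 * ((h (0, 0)).ex1 - (h (1, 0)).ex0) + ubvv 1 * ((h (0, 1)).ex1 - (h (1, 1)).ex0))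

theorem q5_eUD {A B : ℕ} {F : WSp} (h : ∀ g, BH A B (F {g})) : q5 (eUD F) = (A + 3 : ℂ) • pb F := by
  simp only [q5_apply, pb_apply, eUD_pair _ lt1, eUD_pair _ lt2, eUD_pair _ lt3, eUD_pair _ lt4,
    eUD_pair _ lt5, eUD_pair _ lt6, XUD_apply, D_mul, D_two, Derivation.map_one_eq_zero, Dx_x, Dx_y, Dy_y, Dy_x, Dx10, Dy10, Dyx, map_add, map_sub, map_neg, map_mul,
    map_natCast, map_ofNat, map_one, smulC, ulow0, ulow1, ublow0, ublow1, if_true,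
    zero_ne_one, one_ne_zero, if_false, mul_zero, zero_mul, map_zero]
  linear_combination uvv 0 * (((h (0, 0)).dy 1).eulx - ((h (0, 1)).dy 0).eulx) + uvv 1 * (((h (1, 0)).dy 1).eulx - ((h (1, 1)).dy 0).eulx)

theorem q5_eDD {A B : ℕ} {F : WSp} (h : ∀ g, BH A B (F {g})) : q5 (eDD F) = (-(A - 1) : ℂ) • pa F := by
  simp only [q5_apply, pa_apply, eDD_pair _ lt1, eDD_pair _ lt2, eDD_pair _ lt3, eDD_pair _ lt4,
    eDD_pair _ lt5, eDD_pair _ lt6, XDD_apply, D_mul, D_two, Derivation.map_one_eq_zero, Dx_x, Dx_y, Dy_y, Dy_x, Dx10, Dy10, Dyx, map_add, map_sub, map_neg, map_mul,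
    map_natCast, map_ofNat, map_one, smulC, ulow0, ulow1, ublow0, ublow1, if_true,
    zero_ne_one, one_ne_zero, if_false, mul_zero, zero_mul, map_zero]
  linear_combination -((((h (0, 0)).dy 1).ex1 - ((h (0, 1)).dy 0).ex1) - (((h (1, 0)).dy 1).ex0 - ((h (1, 1)).dy 0).ex0))

theorem q2_eUD {A B : ℕ} {F : WSp} (h : ∀ g, BH A B (F {g})) : q2 (eUD F) = (-(2 * B) : ℂ) • pd F := by
  simp only [q2_apply, pd_apply, eUD_pair _ lt1, eUD_pair _ lt2, eUD_pair _ lt3, eUD_pair _ lt4,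
    eUD_pair _ lt5, eUD_pair _ lt6, XUD_apply, D_mul, D_two, Derivation.map_one_eq_zero, Dx_x, Dx_y, Dy_y, Dy_x, Dx10, Dy10, Dyx, map_add, map_sub, map_neg, map_mul,
    map_natCast, map_ofNat, map_one, smulC, ulow0, ulow1, ublow0, ublow1, if_true,
    zero_ne_one, one_ne_zero, if_false, mul_zero, zero_mul, map_zero]
  linear_combination -2 * (ubvv 0 * uvv 0 * (h (0, 0)).euly + ubvv 0 * uvv 1 * (h (1, 0)).euly + ubvv 1 * uvv 0 * (h (0, 1)).euly + ubvv 1 * uvv 1 * (h (1, 1)).euly)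

theorem q2_eDU (F : WSp) : q2 (eDU F) = 0 := by
  simp only [q2_apply, eDU_pair _ lt1, eDU_pair _ lt2, eDU_pair _ lt3, eDU_pair _ lt4,
    eDU_pair _ lt5, eDU_pair _ lt6, XDU_apply, D_mul, D_two, Derivation.map_one_eq_zero, Dx_x, Dx_y, Dy_y, Dy_x, Dx10, Dy10, Dyx, map_add, map_sub, map_neg, map_mul,
    map_natCast, map_ofNat, map_one, smulC, ulow0, ulow1, ublow0, ublow1, if_true,
    zero_ne_one, one_ne_zero, if_false, mul_zero, zero_mul, map_zero]
  ring

theorem q2_eDD {A B : ℕ} {F : WSp} (h : ∀ g, BH A B (F {g})) : q2 (eDD F) = (-(2 * B) : ℂ) • pc F := by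
  simp only [q2_apply, pc_apply, eDD_pair _ lt1, eDD_pair _ lt2, eDD_pair _ lt3, eDD_pair _ lt4,
    eDD_pair _ lt5, eDD_pair _ lt6, XDD_apply, D_mul, D_two, Derivation.map_one_eq_zero, Dx_x, Dx_y, Dy_y, Dy_x, Dx10, Dy10, Dyx, map_add, map_sub, map_neg, map_mul,
    map_natCast, map_ofNat, map_one, smulC, ulow0, ulow1, ublow0, ublow1, if_true,
    zero_ne_one, one_ne_zero, if_false, mul_zero, zero_mul, map_zero]
  linear_combination -2 * (ubvv 0 * ((h (0, 0)).eyd 1 - (h (1, 0)).eyd 0) + ubvv 1 * ((h (0, 1)).eyd 1 - (h (1, 1)).eyd 0))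

theorem q4_eUD (F : WSp) : q4 (eUD F) = 0 := by
  simp only [q4_apply, eUD_pair _ lt1, eUD_pair _ lt2, eUD_pair _ lt3, eUD_pair _ lt4,
    eUD_pair _ lt5, eUD_pair _ lt6, XUD_apply, D_mul, D_two, Derivation.map_one_eq_zero, Dx_x, Dx_y, Dy_y, Dy_x, Dx10, Dy10, Dyx, map_add, map_sub, map_neg, map_mul,
    map_natCast, map_ofNat, map_one, smulC, ulow0, ulow1, ublow0, ublow1, if_true,
    zero_ne_one, one_ne_zero, if_false, mul_zero, zero_mul, map_zero]
  ring

theorem q4_eDU {A B : ℕ} {F : WSp} (h : ∀ g, BH A B (F {g})) : q4 (eDU F) = (2 * (B + 2) : ℂ) • pa F := by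
  simp only [q4_apply, pa_apply, eDU_pair _ lt1, eDU_pair _ lt2, eDU_pair _ lt3, eDU_pair _ lt4,
    eDU_pair _ lt5, eDU_pair _ lt6, XDU_apply, D_mul, D_two, Derivation.map_one_eq_zero, Dx_x, Dx_y, Dy_y, Dy_x, Dx10, Dy10, Dyx, map_add, map_sub, map_neg, map_mul,
    map_natCast, map_ofNat, map_one, smulC, ulow0, ulow1, ublow0, ublow1, if_true,
    zero_ne_one, one_ne_zero, if_false, mul_zero, zero_mul, map_zero]
  linear_combination 2 * (((h (0, 0)).ey1d 1 - (h (1, 0)).ey1d 0) - ((h (0, 1)).ey0d 1 - (h (1, 1)).ey0d 0))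

theorem q4_eDD (F : WSp) : q4 (eDD F) = 0 := by
  simp only [q4_apply, eDD_pair _ lt1, eDD_pair _ lt2, eDD_pair _ lt3, eDD_pair _ lt4,
    eDD_pair _ lt5, eDD_pair _ lt6, XDD_apply, D_mul, D_two, Derivation.map_one_eq_zero, Dx_x, Dx_y, Dy_y, Dy_x, Dx10, Dy10, Dyx, map_add, map_sub, map_neg, map_mul,
    map_natCast, map_ofNat, map_one, smulC, ulow0, ulow1, ublow0, ublow1, if_true,
    zero_ne_one, one_ne_zero, if_false, mul_zero, zero_mul, map_zero]
  ring

theorem q6_eUD {A B : ℕ} {F : WSp} (h : ∀ g, BH A B (F {g})) : q6 (eUD F) = (-(B - 1) : ℂ) • pb F := by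
  simp only [q6_apply, pb_apply, eUD_pair _ lt1, eUD_pair _ lt2, eUD_pair _ lt3, eUD_pair _ lt4,
    eUD_pair _ lt5, eUD_pair _ lt6, XUD_apply, D_mul, D_two, Derivation.map_one_eq_zero, Dx_x, Dx_y, Dy_y, Dy_x, Dx10, Dy10, Dyx, map_add, map_sub, map_neg, map_mul,
    map_natCast, map_ofNat, map_one, smulC, ulow0, ulow1, ublow0, ublow1, if_true,
    zero_ne_one, one_ne_zero, if_false, mul_zero, zero_mul, map_zero]
  linear_combination -(uvv 0 * ((h (0, 0)).ey1 - (h (0, 1)).ey0) + uvv 1 * ((h (1, 0)).ey1 - (h (1, 1)).ey0))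

theorem q6_eDU {A B : ℕ} {F : WSp} (h : ∀ g, BH A B (F {g})) : q6 (eDU F) = (B + 3 : ℂ) • pc F := by
  simp only [q6_apply, pc_apply, eDU_pair _ lt1, eDU_pair _ lt2, eDU_pair _ lt3, eDU_pair _ lt4,
    eDU_pair _ lt5, eDU_pair _ lt6, XDU_apply, D_mul, D_two, Derivation.map_one_eq_zero, Dx_x, Dx_y, Dy_y, Dy_x, Dx10, Dy10, Dyx, map_add, map_sub, map_neg, map_mul,
    map_natCast, map_ofNat, map_one, smulC, ulow0, ulow1, ublow0, ublow1, if_true,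
    zero_ne_one, one_ne_zero, if_false, mul_zero, zero_mul, map_zero]
  linear_combination ubvv 0 * ((h (0, 0)).eyd 1 - (h (1, 0)).eyd 0) + ubvv 1 * ((h (0, 1)).eyd 1 - (h (1, 1)).eyd 0)

theorem q6_eDD {A B : ℕ} {F : WSp} (h : ∀ g, BH A B (F {g})) : q6 (eDD F) = (-(B - 1) : ℂ) • pa F := by
  simp only [q6_apply, pa_apply, eDD_pair _ lt1, eDD_pair _ lt2, eDD_pair _ lt3, eDD_pair _ lt4,
    eDD_pair _ lt5, eDD_pair _ lt6, XDD_apply, D_mul, D_two, Derivation.map_one_eq_zero, Dx_x, Dx_y, Dy_y, Dy_x, Dx10, Dy10, Dyx, map_add, map_sub, map_neg, map_mul,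
    map_natCast, map_ofNat, map_one, smulC, ulow0, ulow1, ublow0, ublow1, if_true,
    zero_ne_one, one_ne_zero, if_false, mul_zero, zero_mul, map_zero]
  linear_combination -(((h (0, 0)).ey1d 1 - (h (1, 0)).ey1d 0) - ((h (0, 1)).ey0d 1 - (h (1, 1)).ey0d 0))


set_option linter.unusedSimpArgs false

theorem card_two (S : Finset GIdx) (hS : S.card = 2) :
    S = {(0, 0), (0, 1)} ∨ S = {(0, 0), (1, 0)} ∨ S = {(0, 0), (1, 1)} ∨
    S = {(0, 1), (1, 0)} ∨ S = {(0, 1), (1, 1)} ∨ S = {(1, 0), (1, 1)} := by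
  revert S; decide

theorem ext_two {T : WSp} (hT : FormDeg 2 T) (h1 : T {(0, 0), (0, 1)} = 0)
    (h2 : T {(0, 0), (1, 0)} = 0) (h3 : T {(0, 0), (1, 1)} = 0) (h4 : T {(0, 1), (1, 0)} = 0)
    (h5 : T {(0, 1), (1, 1)} = 0) (h6 : T {(1, 0), (1, 1)} = 0) : T = 0 := by
  funext S
  by_cases hS : S.card = 2
  · rcases card_two S hS with rfl | rfl | rfl | rfl | rfl | rfl <;> assumption
  · exact hT S hS

theorem formDeg_add {k : ℕ} {F G : WSp} (hF : FormDeg k F) (hG : FormDeg k G) :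
    FormDeg k (F + G) := by
  intro S hS
  rw [Pi.add_apply, hF S hS, hG S hS, add_zero]

theorem formDeg_smul {k : ℕ} {F : WSp} (c : ℂ) (hF : FormDeg k F) : FormDeg k (c • F) := by
  intro S hS
  rw [Pi.smul_apply, hF S hS, smul_zero]

theorem formDeg_zero (k : ℕ) : FormDeg k 0 := fun _ _ => rfl

theorem bihom_add {A B : ℕ} {F G : WSp} (hF : Bihom A B F) (hG : Bihom A B G) :
    Bihom A B (F + G) := fun S => BH.add (hF S) (hG S)

theorem bihom_smul {A B : ℕ} {F : WSp} (c : ℂ) (hF : Bihom A B F) :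
    Bihom A B (c • F) := fun S => BH.smul c (hF S)

theorem bihom_zero (A B : ℕ) : Bihom A B 0 := fun _ => BH.zero _ _

theorem eUU_formDeg {k : ℕ} {F : WSp} (hF : FormDeg k F) : FormDeg (k + 1) (eUU F) := by
  rw [eUU_eq]; exact eGen_formDeg _ hF
theorem eDU_formDeg {k : ℕ} {F : WSp} (hF : FormDeg k F) : FormDeg (k + 1) (eDU F) := by
  rw [eDU_eq]; exact eGen_formDeg _ hF
theorem eUD_formDeg {k : ℕ} {F : WSp} (hF : FormDeg k F) : FormDeg (k + 1) (eUD F) := by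
  rw [eUD_eq]; exact eGen_formDeg _ hF
theorem eDD_formDeg {k : ℕ} {F : WSp} (hF : FormDeg k F) : FormDeg (k + 1) (eDD F) := by
  rw [eDD_eq]; exact eGen_formDeg _ hF

theorem dec_x {A B : ℕ} {p q : Pu} (hp : BH A B p) (hq : BH A B q)
    (h1 : uvv 0 * p + uvv 1 * q = 0) (h2 : Dx 1 p - Dx 0 q = 0) : p = 0 ∧ q = 0 := by
  have e0 := congrArg (Dx 0) h1
  have e1 := congrArg (Dx 1) h1
  simp only [D_mul, Dx_x, map_add, map_zero, if_true, zero_ne_one, one_ne_zero, if_false] at e0 e1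
  have hA : ((A : Pu) + 1) ≠ 0 := by exact_mod_cast Nat.succ_ne_zero A
  constructor
  · have : ((A : Pu) + 1) * p = 0 := by linear_combination e0 - hp.eulx + uvv 1 * h2
    exact (mul_eq_zero.mp this).resolve_left hA
  · have : ((A : Pu) + 1) * q = 0 := by linear_combination e1 - hq.eulx - uvv 0 * h2
    exact (mul_eq_zero.mp this).resolve_left hA

theorem dec_y {A B : ℕ} {p q : Pu} (hp : BH A B p) (hq : BH A B q)
    (h1 : ubvv 0 * p + ubvv 1 * q = 0) (h2 : Dy 1 p - Dy 0 q = 0) : p = 0 ∧ q = 0 := by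
  have e0 := congrArg (Dy 0) h1
  have e1 := congrArg (Dy 1) h1
  simp only [D_mul, Dy_y, map_add, map_zero, if_true, zero_ne_one, one_ne_zero, if_false] at e0 e1
  have hB : ((B : Pu) + 1) ≠ 0 := by exact_mod_cast Nat.succ_ne_zero B
  constructor
  · have : ((B : Pu) + 1) * p = 0 := by linear_combination e0 - hp.euly + ubvv 1 * h2
    exact (mul_eq_zero.mp this).resolve_left hB
  · have : ((B : Pu) + 1) * q = 0 := by linear_combination e1 - hq.euly - ubvv 0 * h2
    exact (mul_eq_zero.mp this).resolve_left hB

theorem one_form_zero {A B : ℕ} {F : WSp} (hF : FormDeg 1 F) (hB : Bihom A B F)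
    (ha : pa F = 0) (hb : pb F = 0) (hc : pc F = 0) (hd : pd F = 0) : F = 0 := by
  have h : ∀ g, BH A B (F {g}) := fun g => hB {g}
  rw [pa_apply] at ha
  rw [pb_apply] at hb
  rw [pc_apply] at hc
  rw [pd_apply] at hd
  have s := dec_x (p := ubvv 0 * F {(0, 0)} + ubvv 1 * F {(0, 1)})
    (q := ubvv 0 * F {(1, 0)} + ubvv 1 * F {(1, 1)}) (((h _).ymul _).add ((h _).ymul _))
    (((h _).ymul _).add ((h _).ymul _)) (by linear_combination hd) (by
      simp only [map_add, D_mul, Dx_y]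
      linear_combination hc)
  have t := dec_x (p := Dy 1 (F {(0, 0)}) - Dy 0 (F {(0, 1)}))
    (q := Dy 1 (F {(1, 0)}) - Dy 0 (F {(1, 1)})) (((h _).dy _).sub ((h _).dy _))
    (((h _).dy _).sub ((h _).dy _)) (by linear_combination hb) (by
      simp only [map_sub]
      linear_combination ha)
  have r0 := dec_y (h _) (h _) s.1 t.1
  have r1 := dec_y (h _) (h _) s.2 t.2
  funext S
  by_cases hS : S.card = 1
  · obtain ⟨⟨a, b⟩, rfl⟩ := Finset.card_eq_one.mp hS
    fin_cases a <;> fin_cases b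
    exacts [r0.1, r0.2, r1.1, r1.2]
  · exact hF S hS

theorem sq_DU {F : WSp} (hF : FormDeg 0 F) : eDU (eDU F) = 0 := by
  apply ext_two (eDU_formDeg (eDU_formDeg hF)) <;>
  · simp only [Pi.add_apply, Pi.smul_apply, eDU_pair _ lt1, eDU_pair _ lt2, eDU_pair _ lt3, eDU_pair _ lt4, eDU_pair _ lt5, eDU_pair _ lt6, eDU_single,
    XDU_apply,
    D_mul, D_two, Derivation.map_one_eq_zero, Dx_x, Dx_y, Dy_y, Dy_x, Dx10, Dy10, Dyx, map_add, map_sub, map_neg, map_mul,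
    map_natCast, map_ofNat, map_one, smulC, ulow0, ulow1, ublow0, ublow1, if_true,
    zero_ne_one, one_ne_zero, if_false, mul_zero, zero_mul, map_zero, Pi.zero_apply]
    ring

theorem sq_UD {F : WSp} (hF : FormDeg 0 F) : eUD (eUD F) = 0 := by
  apply ext_two (eUD_formDeg (eUD_formDeg hF)) <;>
  · simp only [Pi.add_apply, Pi.smul_apply, eUD_pair _ lt1, eUD_pair _ lt2, eUD_pair _ lt3, eUD_pair _ lt4, eUD_pair _ lt5, eUD_pair _ lt6, eUD_single,
    XUD_apply,
    D_mul, D_two, Derivation.map_one_eq_zero, Dx_x, Dx_y, Dy_y, Dy_x, Dx10, Dy10, Dyx, map_add, map_sub, map_neg, map_mul,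
    map_natCast, map_ofNat, map_one, smulC, ulow0, ulow1, ublow0, ublow1, if_true,
    zero_ne_one, one_ne_zero, if_false, mul_zero, zero_mul, map_zero, Pi.zero_apply]
    ring

theorem sq_DD {F : WSp} (hF : FormDeg 0 F) : eDD (eDD F) = 0 := by
  apply ext_two (eDD_formDeg (eDD_formDeg hF)) <;>
  · simp only [Pi.add_apply, Pi.smul_apply, eDD_pair _ lt1, eDD_pair _ lt2, eDD_pair _ lt3, eDD_pair _ lt4, eDD_pair _ lt5, eDD_pair _ lt6, eDD_single,
    XDD_apply,
    D_mul, D_two, Derivation.map_one_eq_zero, Dx_x, Dx_y, Dy_y, Dy_x, Dx10, Dy10, Dyx, map_add, map_sub, map_neg, map_mul,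
    map_natCast, map_ofNat, map_one, smulC, ulow0, ulow1, ublow0, ublow1, if_true,
    zero_ne_one, one_ne_zero, if_false, mul_zero, zero_mul, map_zero, Pi.zero_apply]
    ring

theorem BH.eydd {A B : ℕ} {p : Pu} (hp : BH A B p) (a c : Fin 2) :
    ubvv 0 * Dx a (Dx c (Dy 0 p)) + ubvv 1 * Dx a (Dx c (Dy 1 p)) = (B : Pu) * Dx a (Dx c p) := by
  have h := ((hp.dx c).dx a).euly
  simpa only [Dyx] using h

theorem BH.exyy {A B : ℕ} {p : Pu} (hp : BH A B p) (a c : Fin 2) :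
    uvv 0 * Dx 0 (Dy a (Dy c p)) + uvv 1 * Dx 1 (Dy a (Dy c p)) = (A : Pu) * Dy a (Dy c p) :=
  ((hp.dy c).dy a).eulx

theorem mix_DU {P Q : ℕ} {F : WSp} (hF : FormDeg 0 F) (hB : Bihom P Q F) :
    (Q : ℂ) • eDD (eDU F) + (Q + 2 : ℂ) • eDU (eDD F) = 0 := by
  have h : BH P Q (F ∅) := hB ∅
  apply ext_two (formDeg_add (formDeg_smul _ (eDD_formDeg (eDU_formDeg hF))) (formDeg_smul _ (eDU_formDeg (eDD_formDeg hF))))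
  all_goals
    simp only [Pi.add_apply, Pi.smul_apply, eDD_pair _ lt1, eDD_pair _ lt2, eDD_pair _ lt3, eDD_pair _ lt4, eDD_pair _ lt5, eDD_pair _ lt6, eDU_pair _ lt1, eDU_pair _ lt2, eDU_pair _ lt3, eDU_pair _ lt4, eDU_pair _ lt5, eDU_pair _ lt6, eDD_single, eDU_single,
      XDD_apply, XDU_apply,
      D_mul, D_two, Derivation.map_one_eq_zero, Dx_x, Dx_y, Dy_y, Dy_x, Dx10, Dy10, Dyx, map_add, map_sub, map_neg, map_mul,
      map_natCast, map_ofNat, map_one, smulC, ulow0, ulow1, ublow0, ublow1, if_true,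
      zero_ne_one, one_ne_zero, if_false, mul_zero, zero_mul, map_zero, Pi.zero_apply]
  · linear_combination (1) * ((Q : Pu) - ((Q : Pu) + 2)) * h.eydd 0 0
  · linear_combination (0 : Pu) * h.eulx
  · linear_combination (1) * ((Q : Pu) - ((Q : Pu) + 2)) * h.eydd 0 1
  · linear_combination (-1) * ((Q : Pu) - ((Q : Pu) + 2)) * h.eydd 0 1
  · linear_combination (0 : Pu) * h.eulx
  · linear_combination (1) * ((Q : Pu) - ((Q : Pu) + 2)) * h.eydd 1 1

theorem mix_UD {P Q : ℕ} {F : WSp} (hF : FormDeg 0 F) (hB : Bihom P Q F) :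
    (P : ℂ) • eDD (eUD F) + (P + 2 : ℂ) • eUD (eDD F) = 0 := by
  have h : BH P Q (F ∅) := hB ∅
  apply ext_two (formDeg_add (formDeg_smul _ (eDD_formDeg (eUD_formDeg hF))) (formDeg_smul _ (eUD_formDeg (eDD_formDeg hF))))
  all_goals
    simp only [Pi.add_apply, Pi.smul_apply, eDD_pair _ lt1, eDD_pair _ lt2, eDD_pair _ lt3, eDD_pair _ lt4, eDD_pair _ lt5, eDD_pair _ lt6, eUD_pair _ lt1, eUD_pair _ lt2, eUD_pair _ lt3, eUD_pair _ lt4, eUD_pair _ lt5, eUD_pair _ lt6, eDD_single, eUD_single,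
      XDD_apply, XUD_apply,
      D_mul, D_two, Derivation.map_one_eq_zero, Dx_x, Dx_y, Dy_y, Dy_x, Dx10, Dy10, Dyx, map_add, map_sub, map_neg, map_mul,
      map_natCast, map_ofNat, map_one, smulC, ulow0, ulow1, ublow0, ublow1, if_true,
      zero_ne_one, one_ne_zero, if_false, mul_zero, zero_mul, map_zero, Pi.zero_apply]
  · linear_combination (0 : Pu) * h.eulx
  · linear_combination ((P : Pu) - ((P : Pu) + 2)) * h.exyy 0 0
  · linear_combination ((P : Pu) - ((P : Pu) + 2)) * h.exyy 0 1
  · linear_combination ((P : Pu) - ((P : Pu) + 2)) * h.exyy 0 1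
  · linear_combination ((P : Pu) - ((P : Pu) + 2)) * h.exyy 1 1
  · linear_combination (0 : Pu) * h.eulx


set_option linter.unusedSimpArgs false

theorem mix_UU {P : ℕ} {F : WSp} (hF : FormDeg 0 F) (hB : Bihom P P F) :
    (P + 2 : ℂ) • (eDU (eUD F) + eUD (eDU F)) + (-2 : ℂ) • eDD (eUU F) = 0 := by
  have h : BH P P (F ∅) := hB ∅
  apply ext_two (formDeg_add (formDeg_smul _ (formDeg_add (eDU_formDeg (eUD_formDeg hF))
    (eUD_formDeg (eDU_formDeg hF)))) (formDeg_smul _ (eDD_formDeg (eUU_formDeg hF))))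
  all_goals
    simp only [Pi.add_apply, Pi.smul_apply, eDD_pair _ lt1, eDD_pair _ lt2, eDD_pair _ lt3, eDD_pair _ lt4, eDD_pair _ lt5, eDD_pair _ lt6, eUD_pair _ lt1, eUD_pair _ lt2, eUD_pair _ lt3, eUD_pair _ lt4, eUD_pair _ lt5, eUD_pair _ lt6, eDU_pair _ lt1, eDU_pair _ lt2, eDU_pair _ lt3, eDU_pair _ lt4, eDU_pair _ lt5, eDU_pair _ lt6, eUU_single, eUD_single, eDU_single,
      XDD_apply, XUD_apply, XDU_apply, XUU_apply,
      D_mul, D_two, Derivation.map_one_eq_zero, Dx_x, Dx_y, Dy_y, Dy_x, Dx10, Dy10, Dyx, map_add, map_sub, map_neg, map_mul,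
      map_natCast, map_ofNat, map_one, smulC, ulow0, ulow1, ublow0, ublow1, if_true,
      zero_ne_one, one_ne_zero, if_false, mul_zero, zero_mul, map_zero, Pi.zero_apply]
  · linear_combination (-1) * (-2 * uvv 1 * h.eyd 0) + (0) * (ubvv 0 * (h.dy 0).eulx - ubvv 1 * (h.dy 1).eulx)
  · linear_combination (0) * (uvv 0 * h.eyd 0 - uvv 1 * h.eyd 1) + (-1) * (-2 * ubvv 1 * (h.dy 0).eulx)
  · linear_combination (-1) * (uvv 0 * h.eyd 0 - uvv 1 * h.eyd 1) + (-1) * (ubvv 0 * (h.dy 0).eulx - ubvv 1 * (h.dy 1).eulx)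
  · linear_combination (1) * (uvv 0 * h.eyd 0 - uvv 1 * h.eyd 1) + (-1) * (ubvv 0 * (h.dy 0).eulx - ubvv 1 * (h.dy 1).eulx)
  · linear_combination (0) * (uvv 0 * h.eyd 0 - uvv 1 * h.eyd 1) + (-1) * (2 * ubvv 0 * (h.dy 1).eulx)
  · linear_combination (-1) * (2 * uvv 0 * h.eyd 1) + (0) * (ubvv 0 * (h.dy 0).eulx - ubvv 1 * (h.dy 1).eulx)


/-! ### The operator σ₋ slot by slot -/

def cA (n m r l : ℕ) : ℂ :=
  ((n * (m + r + l + 2) : ℕ) : ℂ) / (((n + r + 1) * (m + r + 1) : ℕ) : ℂ)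
def cB (n m r l : ℕ) : ℂ :=
  ((m * (n + r + l + 2) : ℕ) : ℂ) / (((n + r + 1) * (m + r + 1) : ℕ) : ℂ)
def cG (n m r : ℕ) : ℂ :=
  -(((r * (n + m + r + 1) : ℕ) : ℂ)) / (((n + r + 1) * (m + r + 1) : ℕ) : ℂ)

theorem cA_ne {n m r l : ℕ} (h : 0 < n) : cA n m r l ≠ 0 := by
  unfold cA
  apply div_ne_zero <;> exact Nat.cast_ne_zero.mpr (by positivity)
theorem cB_ne {n m r l : ℕ} (h : 0 < m) : cB n m r l ≠ 0 := by
  unfold cB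
  apply div_ne_zero <;> exact Nat.cast_ne_zero.mpr (by positivity)
theorem cG_ne {n m r : ℕ} (h : 0 < r) : cG n m r ≠ 0 := by
  unfold cG
  apply div_ne_zero
  · apply neg_ne_zero.mpr
    exact Nat.cast_ne_zero.mpr (by positivity)
  · exact Nat.cast_ne_zero.mpr (by positivity)

theorem sigma_eq (ω : Fam) (n m r l : ℕ) : sigmaM ω n m r l =
    (if 1 ≤ m ∧ m - 1 < n + 1 then cA (n + 1) (m - 1) r l • eDU (ω (n + 1) (m - 1) r l) else 0) +
    (if 1 ≤ n ∧ n - 1 < m + 1 then cB (n - 1) (m + 1) r l • eUD (ω (n - 1) (m + 1) r l) else 0) +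
    (if 1 ≤ l then cG n m (r + 1) • eDD (ω n m (r + 1) (l - 1)) else 0) := rfl

/-- σ₋ as a linear map. -/
def sigL : Fam →ₗ[ℂ] Fam where
  toFun := sigmaM
  map_add' x y := by
    funext n m r l
    simp only [Pi.add_apply, sigma_eq, map_add, smul_add]
    split_ifs <;> abel
  map_smul' c x := by
    funext n m r l
    simp only [Pi.smul_apply, sigma_eq, map_smul, RingHom.id_apply, smul_add, smul_ite, smul_zero,
      smul_comm c]

theorem sigL_apply (x : Fam) : sigL x = sigmaM x := rfl

/-- Families form a submodule. -/
theorem IsFam.add {k lh lv : ℕ} {x y : Fam} (hx : IsFam k lh lv x) (hy : IsFam k lh lv y) :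
    IsFam k lh lv (x + y) := by
  intro n m r l
  obtain ⟨a1, a2, a3⟩ := hx n m r l
  obtain ⟨b1, b2, b3⟩ := hy n m r l
  refine ⟨formDeg_add a1 b1, bihom_add a2 b2, fun h => ?_⟩
  simp only [Pi.add_apply, a3 h, b3 h, add_zero]

theorem IsFam.smul {k lh lv : ℕ} {x : Fam} (c : ℂ) (hx : IsFam k lh lv x) :
    IsFam k lh lv (c • x) := by
  intro n m r l
  obtain ⟨a1, a2, a3⟩ := hx n m r l
  refine ⟨formDeg_smul c a1, bihom_smul c a2, fun h => ?_⟩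
  simp only [Pi.smul_apply, a3 h, smul_zero]

theorem IsFam.zero (k lh lv : ℕ) : IsFam k lh lv 0 :=
  fun _ _ _ _ => ⟨formDeg_zero k, bihom_zero _ _, fun _ => rfl⟩

theorem IsFam.sub {k lh lv : ℕ} {x y : Fam} (hx : IsFam k lh lv x) (hy : IsFam k lh lv y) :
    IsFam k lh lv (x - y) := by
  have := hx.add (hy.smul (-1))
  rwa [neg_one_smul, ← sub_eq_add_neg] at this

theorem IsFam.sigma {k lh lv : ℕ} {x : Fam} (hx : IsFam k lh lv x) :
    IsFam (k + 1) lh lv (sigmaM x) := by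
  intro n m r l
  rw [sigma_eq]
  refine ⟨?_, ?_, ?_⟩
  · refine formDeg_add (formDeg_add ?_ ?_) ?_
    · split_ifs
      · exact formDeg_smul _ (eDU_formDeg (hx _ _ _ _).1)
      · exact formDeg_zero _
    · split_ifs
      · exact formDeg_smul _ (eUD_formDeg (hx _ _ _ _).1)
      · exact formDeg_zero _
    · split_ifs
      · exact formDeg_smul _ (eDD_formDeg (hx _ _ _ _).1)
      · exact formDeg_zero _
  · refine bihom_add (bihom_add ?_ ?_) ?_
    · split_ifs with h
      · have := eDU_bihom (hx (n + 1) (m - 1) r l).2.1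
        rw [show n + 1 + r - 1 = n + r by omega, show m - 1 + r + 1 = m + r by omega] at this
        exact bihom_smul _ this
      · exact bihom_zero _ _
    · split_ifs with h
      · have := eUD_bihom (hx (n - 1) (m + 1) r l).2.1
        rw [show n - 1 + r + 1 = n + r by omega, show m + 1 + r - 1 = m + r by omega] at this
        exact bihom_smul _ this
      · exact bihom_zero _ _
    · split_ifs with h
      · have := eDD_bihom (hx n m (r + 1) (l - 1)).2.1
        rw [show n + (r + 1) - 1 = n + r by omega, show m + (r + 1) - 1 = m + r by omega] at this
        exact bihom_smul _ this
      · exact bihom_zero _ _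
  · intro h
    have t1 : (if 1 ≤ m ∧ m - 1 < n + 1 then
        cA (n + 1) (m - 1) r l • eDU (x (n + 1) (m - 1) r l) else 0) = 0 := by
      split_ifs with h1
      · rw [(hx _ _ _ _).2.2 (by omega), map_zero, smul_zero]
      · rfl
    have t2 : (if 1 ≤ n ∧ n - 1 < m + 1 then
        cB (n - 1) (m + 1) r l • eUD (x (n - 1) (m + 1) r l) else 0) = 0 := by
      split_ifs with h1
      · rw [(hx _ _ _ _).2.2 (by omega), map_zero, smul_zero]
      · rfl
    have t3 : (if 1 ≤ l then cG n m (r + 1) • eDD (x n m (r + 1) (l - 1)) else 0) = 0 := by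
      split_ifs with h1
      · rw [(hx _ _ _ _).2.2 (by omega), map_zero, smul_zero]
      · rfl
    rw [t1, t2, t3, add_zero, add_zero]

theorem cf_A (n m r l : ℕ) : ∃ k : ℂ,
    cG n (m + 1) (r + 1) * cA (n + 1) m (r + 1) l = k * (m + r + 1 : ℕ) ∧
    cA (n + 1) m r (l + 1) * cG (n + 1) m (r + 1) = k * ((m + r + 1 : ℕ) + 2) := by
  have e1 : ((n : ℂ) + r + 2) ≠ 0 := by
    exact_mod_cast (show (n + r + 2 : ℕ) ≠ 0 by omega)
  have e2 : ((m : ℂ) + r + 2) ≠ 0 := by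
    exact_mod_cast (show (m + r + 2 : ℕ) ≠ 0 by omega)
  have e3 : ((n : ℂ) + r + 3) ≠ 0 := by
    exact_mod_cast (show (n + r + 3 : ℕ) ≠ 0 by omega)
  have e4 : ((m : ℂ) + r + 3) ≠ 0 := by
    exact_mod_cast (show (m + r + 3 : ℕ) ≠ 0 by omega)
  have e5 : ((m : ℂ) + r + 1) ≠ 0 := by
    exact_mod_cast (show (m + r + 1 : ℕ) ≠ 0 by omega)
  refine ⟨cG n (m + 1) (r + 1) * cA (n + 1) m (r + 1) l / (m + r + 1 : ℕ), ?_, ?_⟩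
  · push_cast
    field_simp
  · unfold cG cA
    push_cast
    rw [show (n : ℂ) + 1 + (r + 1) + 1 = n + r + 3 by ring,
      show (m : ℂ) + 1 + (r + 1) + 1 = m + r + 3 by ring,
      show (n : ℂ) + (r + 1) + 1 = n + r + 2 by ring,
      show (m : ℂ) + (r + 1) + 1 = m + r + 2 by ring,
      show (n : ℂ) + 1 + r + 1 = n + r + 2 by ring]
    field_simp
    ring

theorem cf_B (n m r l : ℕ) : ∃ k : ℂ,
    cG (n + 1) m (r + 1) * cB n (m + 1) (r + 1) l = k * (n + r + 1 : ℕ) ∧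
    cB n (m + 1) r (l + 1) * cG n (m + 1) (r + 1) = k * ((n + r + 1 : ℕ) + 2) := by
  have e1 : ((n : ℂ) + r + 2) ≠ 0 := by
    exact_mod_cast (show (n + r + 2 : ℕ) ≠ 0 by omega)
  have e2 : ((m : ℂ) + r + 2) ≠ 0 := by
    exact_mod_cast (show (m + r + 2 : ℕ) ≠ 0 by omega)
  have e3 : ((n : ℂ) + r + 3) ≠ 0 := by
    exact_mod_cast (show (n + r + 3 : ℕ) ≠ 0 by omega)
  have e4 : ((m : ℂ) + r + 3) ≠ 0 := by
    exact_mod_cast (show (m + r + 3 : ℕ) ≠ 0 by omega)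
  have e5 : ((n : ℂ) + r + 1) ≠ 0 := by
    exact_mod_cast (show (n + r + 1 : ℕ) ≠ 0 by omega)
  refine ⟨cG (n + 1) m (r + 1) * cB n (m + 1) (r + 1) l / (n + r + 1 : ℕ), ?_, ?_⟩
  · push_cast
    field_simp
  · unfold cG cB
    push_cast
    rw [show (n : ℂ) + 1 + (r + 1) + 1 = n + r + 3 by ring,
      show (m : ℂ) + 1 + (r + 1) + 1 = m + r + 3 by ring,
      show (n : ℂ) + (r + 1) + 1 = n + r + 2 by ring,
      show (m : ℂ) + (r + 1) + 1 = m + r + 2 by ring,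
      show (m : ℂ) + 1 + r + 1 = m + r + 2 by ring]
    field_simp
    ring

set_option linter.unusedSimpArgs false

/-! ### σ₋ squares to zero on families of 0-forms -/

def sA (x : Fam) : Fam := fun n m r l =>
  if 1 ≤ m ∧ m - 1 < n + 1 then cA (n + 1) (m - 1) r l • eDU (x (n + 1) (m - 1) r l) else 0
def sB (x : Fam) : Fam := fun n m r l =>
  if 1 ≤ n ∧ n - 1 < m + 1 then cB (n - 1) (m + 1) r l • eUD (x (n - 1) (m + 1) r l) else 0
def sC (x : Fam) : Fam := fun n m r l =>
  if 1 ≤ l then cG n m (r + 1) • eDD (x n m (r + 1) (l - 1)) else 0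

theorem sigma_split (x : Fam) : sigmaM x = sA x + sB x + sC x := by
  funext n m r l
  rw [sigma_eq]
  rfl

theorem sA_add (x y : Fam) : sA (x + y) = sA x + sA y := by
  funext n m r l
  simp only [sA, Pi.add_apply, map_add, smul_add]
  split_ifs <;> simp
theorem sB_add (x y : Fam) : sB (x + y) = sB x + sB y := by
  funext n m r l
  simp only [sB, Pi.add_apply, map_add, smul_add]
  split_ifs <;> simp
theorem sC_add (x y : Fam) : sC (x + y) = sC x + sC y := by
  funext n m r l
  simp only [sC, Pi.add_apply, map_add, smul_add]
  split_ifs <;> simp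

section
variable {lh lv : ℕ} {x : Fam}

theorem sAA (hx : IsFam 0 lh lv x) : sA (sA x) = 0 := by
  funext n m r l
  simp only [sA, Pi.zero_apply]
  split_ifs with h1 h2
  · rw [map_smul, sq_DU (hx _ _ _ _).1, smul_zero, smul_zero]
  · rw [map_zero, smul_zero]
  · rfl

theorem sBB (hx : IsFam 0 lh lv x) : sB (sB x) = 0 := by
  funext n m r l
  simp only [sB, Pi.zero_apply]
  split_ifs with h1 h2
  · rw [map_smul, sq_UD (hx _ _ _ _).1, smul_zero, smul_zero]
  · rw [map_zero, smul_zero]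
  · rfl

theorem sCC (hx : IsFam 0 lh lv x) : sC (sC x) = 0 := by
  funext n m r l
  simp only [sC, Pi.zero_apply]
  split_ifs with h1 h2
  · rw [map_smul, sq_DD (hx _ _ _ _).1, smul_zero, smul_zero]
  · rw [map_zero, smul_zero]
  · rfl

theorem sAB (hlh : Even lh) (hx : IsFam 0 lh lv x) : sA (sB x) = 0 := by
  obtain ⟨N, hN⟩ := hlh
  funext n m r l
  simp only [sA, sB, Pi.zero_apply]
  split_ifs with h1 h2
  · rw [(hx _ _ _ _).2.2 (by omega), map_zero, smul_zero, map_zero, smul_zero]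
  · rw [map_zero, smul_zero]
  · rfl

theorem sBA (hlh : Even lh) (hx : IsFam 0 lh lv x) : sB (sA x) = 0 := by
  obtain ⟨N, hN⟩ := hlh
  funext n m r l
  simp only [sA, sB, Pi.zero_apply]
  split_ifs with h1 h2
  · rw [(hx _ _ _ _).2.2 (by omega), map_zero, smul_zero, map_zero, smul_zero]
  · rw [map_zero, smul_zero]
  · rfl

theorem sAC (hx : IsFam 0 lh lv x) : sA (sC x) + sC (sA x) = 0 := by
  funext n m r l
  simp only [sA, sC, Pi.zero_apply, Pi.add_apply]
  by_cases h1 : 1 ≤ m ∧ m - 1 < n + 1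
  · by_cases h2 : 1 ≤ l
    · rw [if_pos h1, if_pos h1, if_pos h2, if_pos h2]
      obtain ⟨m, rfl⟩ : ∃ m', m = m' + 1 := ⟨m - 1, by omega⟩
      obtain ⟨l, rfl⟩ : ∃ l', l = l' + 1 := ⟨l - 1, by omega⟩
      simp only [Nat.add_sub_cancel, map_smul, smul_smul]
      obtain ⟨k, k1, k2⟩ := cf_A n m r l
      rw [k1, k2, mul_smul, mul_smul, ← smul_add]
      have := mix_DU (hx (n + 1) m (r + 1) l).1 (hx (n + 1) m (r + 1) l).2.1
      rw [show m + (r + 1) = m + r + 1 by ring] at this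
      rw [add_comm, this, smul_zero]
    · rw [if_neg h2, if_neg h2]
      simp
  · simp only [if_neg h1, map_zero, smul_zero, ite_self, add_zero]

theorem sBC (hx : IsFam 0 lh lv x) : sB (sC x) + sC (sB x) = 0 := by
  funext n m r l
  simp only [sB, sC, Pi.zero_apply, Pi.add_apply]
  by_cases h1 : 1 ≤ n ∧ n - 1 < m + 1
  · by_cases h2 : 1 ≤ l
    · rw [if_pos h1, if_pos h1, if_pos h2, if_pos h2]
      obtain ⟨n, rfl⟩ : ∃ n', n = n' + 1 := ⟨n - 1, by omega⟩
      obtain ⟨l, rfl⟩ : ∃ l', l = l' + 1 := ⟨l - 1, by omega⟩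
      simp only [Nat.add_sub_cancel, map_smul, smul_smul]
      obtain ⟨k, k1, k2⟩ := cf_B n m r l
      rw [k1, k2, mul_smul, mul_smul, ← smul_add]
      have := mix_UD (hx n (m + 1) (r + 1) l).1 (hx n (m + 1) (r + 1) l).2.1
      rw [show n + (r + 1) = n + r + 1 by ring] at this
      rw [add_comm, this, smul_zero]
    · rw [if_neg h2, if_neg h2]
      simp
  · simp only [if_neg h1, map_zero, smul_zero, ite_self, add_zero]

end

theorem sigma_sq {lh lv : ℕ} {x : Fam} (hlh : Even lh) (hx : IsFam 0 lh lv x) :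
    sigmaM (sigmaM x) = 0 := by
  have h1 := sAA hx
  have h2 := sBB hx
  have h3 := sCC hx
  have h4 := sAB hlh hx
  have h5 := sBA hlh hx
  have h6 := sAC hx
  have h7 := sBC hx
  rw [sigma_split (sigmaM x), sigma_split x]
  simp only [sA_add, sB_add, sC_add, h1, h2, h3, h4, h5, zero_add, add_zero]
  calc sA (sC x) + sB (sC x) + (sC (sA x) + sC (sB x))
      = (sA (sC x) + sC (sA x)) + (sB (sC x) + sC (sB x)) := by abel
    _ = 0 := by rw [h6, h7, add_zero]

/-! ### Projections of the closedness equation -/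

section
variable {lh lv : ℕ} {w : Fam}

theorem slot_eq (hs : sigmaM w = 0) (n m r l : ℕ) :
    (if 1 ≤ m ∧ m - 1 < n + 1 then cA (n + 1) (m - 1) r l • eDU (w (n + 1) (m - 1) r l) else 0) +
    (if 1 ≤ n ∧ n - 1 < m + 1 then cB (n - 1) (m + 1) r l • eUD (w (n - 1) (m + 1) r l) else 0) +
    (if 1 ≤ l then cG n m (r + 1) • eDD (w n m (r + 1) (l - 1)) else 0) = 0 := by
  rw [← sigma_eq, hs]
  rfl

theorem IsFam.bh {k : ℕ} (hw : IsFam k lh lv w) (n m r l : ℕ) (S : Finset GIdx) :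
    BH (n + r) (m + r) (w n m r l S) := (hw n m r l).2.1 S

/-- The `H(∂,∂)` component. -/
theorem E1 (hw : IsFam 1 lh lv w) (hs : sigmaM w = 0) (n m r l : ℕ) :
    (if 1 ≤ m ∧ m - 1 < n + 1 then
      cA (n + 1) (m - 1) r l • (-(2 * ((n + 1 + r : ℕ) : ℂ))) • pd (w (n + 1) (m - 1) r l) else 0) +
    (if 1 ≤ l then
      cG n m (r + 1) • (-(2 * ((n + (r + 1) : ℕ) : ℂ))) • pb (w n m (r + 1) (l - 1)) else 0) = 0 := by
  have h := congrArg q1 (slot_eq hs n m r l)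
  simp only [map_add, map_zero, apply_ite q1, map_smul, q1_eUD, smul_zero, ite_self, add_zero] at h
  rw [q1_eDU fun g => hw.bh _ _ _ _ {g}, q1_eDD fun g => hw.bh _ _ _ _ {g}] at h
  exact h

theorem E2 (hw : IsFam 1 lh lv w) (hs : sigmaM w = 0) (n m r l : ℕ) :
    (if 1 ≤ n ∧ n - 1 < m + 1 then
      cB (n - 1) (m + 1) r l • (-(2 * ((m + 1 + r : ℕ) : ℂ))) • pd (w (n - 1) (m + 1) r l) else 0) +
    (if 1 ≤ l then
      cG n m (r + 1) • (-(2 * ((m + (r + 1) : ℕ) : ℂ))) • pc (w n m (r + 1) (l - 1)) else 0) = 0 := by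
  have h := congrArg q2 (slot_eq hs n m r l)
  simp only [map_add, map_zero, apply_ite q2, map_smul, q2_eDU, smul_zero, ite_self, zero_add] at h
  rw [q2_eUD fun g => hw.bh _ _ _ _ {g}, q2_eDD fun g => hw.bh _ _ _ _ {g}] at h
  exact h

theorem E3 (hw : IsFam 1 lh lv w) (hs : sigmaM w = 0) (n m r l : ℕ) (hnm : n < m) :
    pa (w n m r l) = 0 := by
  obtain ⟨m, rfl⟩ : ∃ m', m = m' + 1 := ⟨m - 1, by omega⟩
  have h := congrArg q3 (slot_eq hs (n + 1) m r l)
  simp only [map_add, map_zero, apply_ite q3, map_smul, q3_eDU, q3_eDD, smul_zero, ite_self,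
    zero_add, add_zero] at h
  rw [if_pos (by omega), Nat.add_sub_cancel, q3_eUD fun g => hw.bh _ _ _ _ {g}] at h
  have e : (2 * (((n + r : ℕ) : ℂ) + 2)) ≠ 0 := by
    exact_mod_cast (show (2 * (n + r + 2) : ℕ) ≠ 0 by omega)
  exact (smul_eq_zero_iff_right e).mp ((smul_eq_zero_iff_right (cB_ne (by omega))).mp h)

theorem E4 (hw : IsFam 1 lh lv w) (hs : sigmaM w = 0) (n m r l : ℕ) (hnm : m < n) :
    pa (w n m r l) = 0 := by
  obtain ⟨n, rfl⟩ : ∃ n', n = n' + 1 := ⟨n - 1, by omega⟩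
  have h := congrArg q4 (slot_eq hs n (m + 1) r l)
  simp only [map_add, map_zero, apply_ite q4, map_smul, q4_eUD, q4_eDD, smul_zero, ite_self,
    zero_add, add_zero] at h
  rw [if_pos (by omega), Nat.add_sub_cancel, q4_eDU fun g => hw.bh _ _ _ _ {g}] at h
  have e : (2 * (((m + r : ℕ) : ℂ) + 2)) ≠ 0 := by
    exact_mod_cast (show (2 * (m + r + 2) : ℕ) ≠ 0 by omega)
  exact (smul_eq_zero_iff_right e).mp ((smul_eq_zero_iff_right (cA_ne (by omega))).mp h)

theorem E5 (hw : IsFam 1 lh lv w) (hs : sigmaM w = 0) (n m r l : ℕ) :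
    (if 1 ≤ m ∧ m - 1 < n + 1 then
      cA (n + 1) (m - 1) r l • (-((n + r : ℕ) : ℂ)) • pc (w (n + 1) (m - 1) r l) else 0) +
    (if 1 ≤ n ∧ n - 1 < m + 1 then
      cB (n - 1) (m + 1) r l • (((n + r : ℕ) : ℂ) + 2) • pb (w (n - 1) (m + 1) r l) else 0) +
    (if 1 ≤ l then
      cG n m (r + 1) • (-((n + r : ℕ) : ℂ)) • pa (w n m (r + 1) (l - 1)) else 0) = 0 := by
  have h := congrArg q5 (slot_eq hs n m r l)
  simp only [map_add, map_zero, apply_ite q5, map_smul] at h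
  rw [q5_eDU fun g => hw.bh _ _ _ _ {g}, q5_eUD fun g => hw.bh _ _ _ _ {g},
    q5_eDD fun g => hw.bh _ _ _ _ {g}] at h
  refine Eq.trans ?_ h
  congr 1
  · congr 1
    · congr 3
      push_cast
      ring
    · split_ifs with h1
      · congr 2
        obtain ⟨n, rfl⟩ : ∃ n', n = n' + 1 := ⟨n - 1, by omega⟩
        rw [Nat.add_sub_cancel]
        push_cast
        ring
      · rfl
  · congr 3
    push_cast
    ring

theorem E6 (hw : IsFam 1 lh lv w) (hs : sigmaM w = 0) (n m r l : ℕ) :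
    (if 1 ≤ m ∧ m - 1 < n + 1 then
      cA (n + 1) (m - 1) r l • (((m + r : ℕ) : ℂ) + 2) • pc (w (n + 1) (m - 1) r l) else 0) +
    (if 1 ≤ n ∧ n - 1 < m + 1 then
      cB (n - 1) (m + 1) r l • (-((m + r : ℕ) : ℂ)) • pb (w (n - 1) (m + 1) r l) else 0) +
    (if 1 ≤ l then
      cG n m (r + 1) • (-((m + r : ℕ) : ℂ)) • pa (w n m (r + 1) (l - 1)) else 0) = 0 := by
  have h := congrArg q6 (slot_eq hs n m r l)
  simp only [map_add, map_zero, apply_ite q6, map_smul] at h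
  rw [q6_eDU fun g => hw.bh _ _ _ _ {g}, q6_eUD fun g => hw.bh _ _ _ _ {g},
    q6_eDD fun g => hw.bh _ _ _ _ {g}] at h
  refine Eq.trans ?_ h
  congr 1
  · congr 1
    · split_ifs with h1
      · congr 2
        obtain ⟨m, rfl⟩ : ∃ m', m = m' + 1 := ⟨m - 1, by omega⟩
        rw [Nat.add_sub_cancel]
        push_cast
        ring
      · rfl
    · congr 3
      push_cast
      ring
  · congr 3
    push_cast
    ring

end

/-! ### The gauge conditions and the uniqueness lemma -/

/-- The gauge conditions. -/
structure Gauge (N : ℕ) (w : Fam) : Prop where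
  g1 : ∀ n m r l, 1 ≤ m → m ≤ n + 1 → pb (w n m r l) = 0
  g2 : ∀ n m r l, 1 ≤ n → n ≤ m + 1 → pc (w n m r l) = 0
  g3 : ∀ r l, 1 ≤ l → pd (w N N r l) = 0

theorem smul2 {a b : ℂ} {p : Pu} (ha : a ≠ 0) (hb : b ≠ 0) (h : a • b • p = 0) : p = 0 :=
  (smul_eq_zero_iff_right hb).mp ((smul_eq_zero_iff_right ha).mp h)

theorem pb_bot {A : ℕ} {F : WSp} (h : Bihom A 0 F) : pb F = 0 := by
  rw [pb_apply, Dy_zero 1 (h {(0, 0)}), Dy_zero 0 (h {(0, 1)}), Dy_zero 1 (h {(1, 0)}),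
    Dy_zero 0 (h {(1, 1)})]
  ring

theorem pc_bot {B : ℕ} {F : WSp} (h : Bihom 0 B F) : pc F = 0 := by
  rw [pc_apply, Dx_zero 1 (h {(0, 0)}), Dx_zero 1 (h {(0, 1)}), Dx_zero 0 (h {(1, 0)}),
    Dx_zero 0 (h {(1, 1)})]
  ring

theorem pa_bot {A : ℕ} {F : WSp} (h : Bihom A 0 F) : pa F = 0 := by
  rw [pa_apply, Dy_zero 1 (h {(0, 0)}), Dy_zero 0 (h {(0, 1)}), Dy_zero 1 (h {(1, 0)}),
    Dy_zero 0 (h {(1, 1)})]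
  simp

theorem neg_two_ne {k : ℕ} (hk : 0 < k) : (-(2 * (k : ℂ))) ≠ 0 := by
  apply neg_ne_zero.mpr
  exact_mod_cast (show (2 * k : ℕ) ≠ 0 by omega)

theorem neg_nat_ne {k : ℕ} (hk : 0 < k) : (-(k : ℂ)) ≠ 0 := by
  apply neg_ne_zero.mpr
  exact_mod_cast (show (k : ℕ) ≠ 0 by omega)

theorem nat_add_two_ne (k : ℕ) : ((k : ℂ) + 2) ≠ 0 := by
  exact_mod_cast (show (k + 2 : ℕ) ≠ 0 by omega)

section
variable {N L lh lv : ℕ} {w : Fam}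

/-- `e(∂,ū)`-components vanish for `m = 0` or `n + 2 ≤ m`, except at one slot. -/
theorem pb_of_r (hw : IsFam 1 lh lv w) (hs : sigmaM w = 0)
    {n m r l : ℕ} (hnm : m = 0 ∨ n + 2 ≤ m) (hr : 1 ≤ r) : pb (w n m r l) = 0 := by
  obtain ⟨r, rfl⟩ : ∃ r', r = r' + 1 := ⟨r - 1, by omega⟩
  have h := E1 hw hs n m r (l + 1)
  rw [if_neg (by omega), if_pos (by omega), zero_add, Nat.add_sub_cancel] at h
  exact smul2 (cG_ne (by omega)) (neg_two_ne (by omega)) h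

theorem pc_of_r (hw : IsFam 1 lh lv w) (hs : sigmaM w = 0)
    {n m r l : ℕ} (hnm : n = 0 ∨ m + 2 ≤ n) (hr : 1 ≤ r) : pc (w n m r l) = 0 := by
  obtain ⟨r, rfl⟩ : ∃ r', r = r' + 1 := ⟨r - 1, by omega⟩
  have h := E2 hw hs n m r (l + 1)
  rw [if_neg (by omega), if_pos (by omega), zero_add, Nat.add_sub_cancel] at h
  exact smul2 (cG_ne (by omega)) (neg_two_ne (by omega)) h

theorem special (hlh : lh = N + N) (hlv : lv = L + L) (hw : IsFam 1 lh lv w) (hs : sigmaM w = 0)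
    (h1 : 1 ≤ L → pa (w N N 1 (L - 1)) = 0) (l : ℕ) (hN : 1 ≤ N) :
    pb (w (N - 1) (N + 1) 0 l) = 0 ∧ pc (w (N + 1) (N - 1) 0 l) = 0 := by
  by_cases hl : l = L
  swap
  · rw [(hw (N - 1) (N + 1) 0 l).2.2 (by omega), (hw (N + 1) (N - 1) 0 l).2.2 (by omega)]
    simp
  subst hl
  have h5 := E5 hw hs N N 0 l
  have h6 := E6 hw hs N N 0 l
  have ha : (if 1 ≤ l then cG N N (0 + 1) • (-((N + 0 : ℕ) : ℂ)) • pa (w N N (0 + 1) (l - 1))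
      else 0) = 0 := by
    split_ifs with hl
    · rw [zero_add, h1 hl, smul_zero, smul_zero]
    · rfl
  rw [ha, add_zero, if_pos (by omega), if_pos (by omega)] at h5 h6
  have hA : cA (N + 1) (N - 1) 0 l ≠ 0 := cA_ne (by omega)
  have hB : cB (N - 1) (N + 1) 0 l ≠ 0 := cB_ne (by omega)
  generalize cA (N + 1) (N - 1) 0 l = α at *
  generalize cB (N - 1) (N + 1) 0 l = β at *
  generalize pb (w (N - 1) (N + 1) 0 l) = b at *
  generalize pc (w (N + 1) (N - 1) 0 l) = c at *
  rw [add_zero] at h5 h6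
  have e : (4 * ((N : ℂ) + 1)) ≠ 0 := by
    exact_mod_cast (show (4 * (N + 1) : ℕ) ≠ 0 by omega)
  have k1 : (4 * ((N : ℂ) + 1)) • β • b = 0 := by
    have := congrArg₂ (fun p q => ((N : ℂ) + 2) • p + (N : ℂ) • q) h5 h6
    simp only [smul_zero, add_zero, smulC, map_add, map_mul, map_neg, map_ofNat, map_one] at this ⊢
    linear_combination this
  have k2 : (4 * ((N : ℂ) + 1)) • α • c = 0 := by
    have := congrArg₂ (fun p q => (N : ℂ) • p + ((N : ℂ) + 2) • q) h5 h6
    simp only [smul_zero, add_zero, smulC, map_add, map_mul, map_neg, map_ofNat, map_one] at this ⊢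
    linear_combination this
  exact ⟨smul2 e hB k1, smul2 e hA k2⟩

theorem gauge_unique (hlh : lh = N + N) (hlv : lv = L + L) (hw : IsFam 1 lh lv w)
    (hs : sigmaM w = 0) (hg : Gauge N w) (hd : pd (w N N L 0) = 0) (h0 : pa (w N N 0 L) = 0)
    (h1 : 1 ≤ L → pa (w N N 1 (L - 1)) = 0) : w = 0 := by
  have pa_off : ∀ n m r l, n ≠ m → pa (w n m r l) = 0 := by
    intro n m r l h
    rcases Nat.lt_or_gt_of_ne h with h | h
    · exact E3 hw hs n m r l h
    · exact E4 hw hs n m r l h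
  have hpd : ∀ n m r l, pd (w n m r l) = 0 := by
    intro n m r l
    rcases Nat.lt_trichotomy n m with h | h | h
    · obtain ⟨m, rfl⟩ : ∃ m', m = m' + 1 := ⟨m - 1, by omega⟩
      have h := E2 hw hs (n + 1) m r l
      have hz : (if 1 ≤ l then cG (n + 1) m (r + 1) • (-(2 * ((m + (r + 1) : ℕ) : ℂ))) •
          pc (w (n + 1) m (r + 1) (l - 1)) else 0) = 0 := by
        rw [hg.g2 _ _ _ _ (by omega) (by omega), smul_zero, smul_zero, ite_self]
      rw [hz, add_zero, if_pos (by omega), Nat.add_sub_cancel] at h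
      exact smul2 (cB_ne (by omega)) (neg_two_ne (by omega)) h
    · subst h
      by_cases hn : n + n = lh ∧ 2 * (r + l) = lv
      · obtain rfl : n = N := by omega
        by_cases hl : 1 ≤ l
        · exact hg.g3 r l hl
        · obtain rfl : l = 0 := by omega
          obtain rfl : r = L := by omega
          exact hd
      · rw [(hw _ _ _ _).2.2 hn, map_zero]
    · obtain ⟨n, rfl⟩ : ∃ n', n = n' + 1 := ⟨n - 1, by omega⟩
      have h := E1 hw hs n (m + 1) r l
      have hz : (if 1 ≤ l then cG n (m + 1) (r + 1) • (-(2 * ((n + (r + 1) : ℕ) : ℂ))) •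
          pb (w n (m + 1) (r + 1) (l - 1)) else 0) = 0 := by
        rw [hg.g1 _ _ _ _ (by omega) (by omega), smul_zero, smul_zero, ite_self]
      rw [hz, add_zero, if_pos (by omega), Nat.add_sub_cancel] at h
      exact smul2 (cA_ne (by omega)) (neg_two_ne (by omega)) h
  have hpb : ∀ n m r l, pb (w n m r l) = 0 := by
    intro n m r l
    by_cases hm : 1 ≤ m ∧ m ≤ n + 1
    · exact hg.g1 _ _ _ _ hm.1 hm.2
    by_cases hr : 1 ≤ r
    · exact pb_of_r hw hs (by omega) hr
    obtain rfl : r = 0 := by omega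
    by_cases hm0 : m = 0
    · subst hm0
      exact pb_bot (hw n 0 0 l).2.1
    by_cases hsup : n + m = lh
    swap
    · rw [(hw _ _ _ _).2.2 (by omega), map_zero]
    by_cases hsp : m = n + 2
    · have := (special hlh hlv hw hs h1 l (by omega)).1
      rwa [show N - 1 = n by omega, show N + 1 = m by omega] at this
    · obtain ⟨m, rfl⟩ : ∃ m', m = m' + 1 := ⟨m - 1, by omega⟩
      have h := E5 hw hs (n + 1) m 0 l
      have hz : (if 1 ≤ l then cG (n + 1) m (0 + 1) • (-((n + 1 + 0 : ℕ) : ℂ)) •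
          pa (w (n + 1) m (0 + 1) (l - 1)) else 0) = 0 := by
        rw [pa_off _ _ _ _ (by omega), smul_zero, smul_zero, ite_self]
      rw [hz, add_zero, if_neg (by omega), zero_add, if_pos (by omega), Nat.add_sub_cancel] at h
      exact smul2 (cB_ne (by omega)) (nat_add_two_ne _) h
  have hpc : ∀ n m r l, pc (w n m r l) = 0 := by
    intro n m r l
    by_cases hm : 1 ≤ n ∧ n ≤ m + 1
    · exact hg.g2 _ _ _ _ hm.1 hm.2
    by_cases hr : 1 ≤ r
    · exact pc_of_r hw hs (by omega) hr
    obtain rfl : r = 0 := by omega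
    by_cases hm0 : n = 0
    · subst hm0
      exact pc_bot (hw 0 m 0 l).2.1
    by_cases hsup : n + m = lh
    swap
    · rw [(hw _ _ _ _).2.2 (by omega), map_zero]
    by_cases hsp : n = m + 2
    · have := (special hlh hlv hw hs h1 l (by omega)).2
      rwa [show N - 1 = m by omega, show N + 1 = n by omega] at this
    · obtain ⟨n, rfl⟩ : ∃ n', n = n' + 1 := ⟨n - 1, by omega⟩
      have h := E6 hw hs n (m + 1) 0 l
      have hz : (if 1 ≤ l then cG n (m + 1) (0 + 1) • (-((m + 1 + 0 : ℕ) : ℂ)) •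
          pa (w n (m + 1) (0 + 1) (l - 1)) else 0) = 0 := by
        rw [pa_off _ _ _ _ (by omega), smul_zero, smul_zero, ite_self]
      rw [hz, add_zero, if_pos (by omega), if_neg (by omega), add_zero, Nat.add_sub_cancel] at h
      exact smul2 (cA_ne (by omega)) (nat_add_two_ne _) h
  have hpa : ∀ n m r l, pa (w n m r l) = 0 := by
    intro n m r l
    by_cases hn : n + m = lh ∧ 2 * (r + l) = lv
    swap
    · rw [(hw _ _ _ _).2.2 hn, map_zero]
    by_cases hnm : n = m
    swap
    · exact pa_off _ _ _ _ hnm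
    subst hnm
    obtain rfl : n = N := by omega
    by_cases hr0 : r = 0
    · subst hr0
      obtain rfl : l = L := by omega
      exact h0
    by_cases hr1 : r = 1
    · subst hr1
      rw [show l = L - 1 by omega]
      exact h1 (by omega)
    obtain ⟨r, rfl⟩ : ∃ r', r = r' + 1 := ⟨r - 1, by omega⟩
    have h := E5 hw hs n n r (l + 1)
    rw [hpc, hpb] at h
    simp only [smul_zero, ite_self, zero_add] at h
    rw [if_pos (by omega), Nat.add_sub_cancel] at h
    exact smul2 (cG_ne (by omega)) (neg_nat_ne (by omega)) h
  funext n m r l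
  exact one_form_zero (hw n m r l).1 (hw n m r l).2.1 (hpa _ _ _ _) (hpb _ _ _ _) (hpc _ _ _ _)
    (hpd _ _ _ _)

end

/-! ### The generators of `C¹` -/

structure Good (lh lv N : ℕ) (x : Fam) : Prop where
  fam : IsFam 1 lh lv x
  closed : sigmaM x = 0
  gauge : Gauge N x

theorem Gauge.add {N : ℕ} {x y : Fam} (hx : Gauge N x) (hy : Gauge N y) : Gauge N (x + y) where
  g1 n m r l h h' := by simp only [Pi.add_apply, map_add, hx.g1 _ _ _ _ h h', hy.g1 _ _ _ _ h h', add_zero]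
  g2 n m r l h h' := by simp only [Pi.add_apply, map_add, hx.g2 _ _ _ _ h h', hy.g2 _ _ _ _ h h', add_zero]
  g3 r l h := by simp only [Pi.add_apply, map_add, hx.g3 _ _ h, hy.g3 _ _ h, add_zero]

theorem Gauge.smul {N : ℕ} {x : Fam} (c : ℂ) (hx : Gauge N x) : Gauge N (c • x) where
  g1 n m r l h h' := by simp only [Pi.smul_apply, map_smul, hx.g1 _ _ _ _ h h', smul_zero]
  g2 n m r l h h' := by simp only [Pi.smul_apply, map_smul, hx.g2 _ _ _ _ h h', smul_zero]
  g3 r l h := by simp only [Pi.smul_apply, map_smul, hx.g3 _ _ h, smul_zero]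

theorem Good.add {lh lv N : ℕ} {x y : Fam} (hx : Good lh lv N x) (hy : Good lh lv N y) :
    Good lh lv N (x + y) where
  fam := hx.fam.add hy.fam
  closed := by rw [← sigL_apply, map_add, sigL_apply, sigL_apply, hx.closed, hy.closed, add_zero]
  gauge := hx.gauge.add hy.gauge

theorem Good.smul {lh lv N : ℕ} {x : Fam} (c : ℂ) (hx : Good lh lv N x) :
    Good lh lv N (c • x) where
  fam := hx.fam.smul c
  closed := by rw [← sigL_apply, map_smul, sigL_apply, hx.closed, smul_zero]
  gauge := hx.gauge.smul c

theorem Good.zero (lh lv N : ℕ) : Good lh lv N 0 where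
  fam := IsFam.zero _ _ _
  closed := by rw [← sigL_apply, map_zero]
  gauge := ⟨fun _ _ _ _ _ _ => map_zero _, fun _ _ _ _ _ _ => map_zero _, fun _ _ _ => map_zero _⟩

theorem isFam_single {k lh lv n m r l : ℕ} {F : WSp} (hF : FormDeg k F)
    (hB : Bihom (n + r) (m + r) F) (h1 : n + m = lh) (h2 : 2 * (r + l) = lv) :
    IsFam k lh lv (singleSlot n m r l F) := by
  intro n' m' r' l'
  unfold singleSlot
  split_ifs with h
  · obtain ⟨rfl, rfl, rfl, rfl⟩ := h
    exact ⟨hF, hB, fun h => absurd ⟨h1, h2⟩ h⟩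
  · exact ⟨formDeg_zero _, bihom_zero _ _, fun _ => rfl⟩

theorem p_single (p : WSp →ₗ[ℂ] Pu) (n m r l : ℕ) (F : WSp) (n' m' r' l' : ℕ) :
    p (singleSlot n m r l F n' m' r' l') = if n' = n ∧ m' = m ∧ r' = r ∧ l' = l then p F else 0 := by
  unfold singleSlot
  rw [apply_ite p, map_zero]

theorem single_self (n m r l : ℕ) (F : WSp) : singleSlot n m r l F n m r l = F := by
  simp [singleSlot]

theorem single_ne {n m r l : ℕ} {F : WSp} {n' m' r' l' : ℕ}
    (h : ¬(n' = n ∧ m' = m ∧ r' = r ∧ l' = l)) : singleSlot n m r l F n' m' r' l' = 0 := by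
  simp only [singleSlot, if_neg h]

theorem single_add (n m r l : ℕ) (F G : WSp) :
    singleSlot n m r l F + singleSlot n m r l G = singleSlot n m r l (F + G) := by
  funext n' m' r' l'
  simp only [singleSlot, Pi.add_apply]
  split_ifs <;> simp

theorem single_smul (c : ℂ) (n m r l : ℕ) (F : WSp) :
    c • singleSlot n m r l F = singleSlot n m r l (c • F) := by
  funext n' m' r' l'
  simp only [singleSlot, Pi.smul_apply]
  split_ifs <;> simp

theorem single_zero (n m r l : ℕ) : singleSlot n m r l 0 = 0 := by
  funext n' m' r' l'
  simp [singleSlot]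

/-- On the diagonal only the `e(∂,∂̄)` term survives. -/
theorem sigma_diag (N r l : ℕ) (F : WSp) :
    sigmaM (singleSlot N N (r + 1) l F) = singleSlot N N r (l + 1) (cG N N (r + 1) • eDD F) := by
  funext n m r' l'
  rw [sigma_eq]
  have t1 : (if 1 ≤ m ∧ m - 1 < n + 1 then cA (n + 1) (m - 1) r' l' •
      eDU (singleSlot N N (r + 1) l F (n + 1) (m - 1) r' l') else 0) = 0 := by
    split_ifs with h
    · rw [single_ne (by omega), map_zero, smul_zero]
    · rfl
  have t2 : (if 1 ≤ n ∧ n - 1 < m + 1 then cB (n - 1) (m + 1) r' l' •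
      eUD (singleSlot N N (r + 1) l F (n - 1) (m + 1) r' l') else 0) = 0 := by
    split_ifs with h
    · rw [single_ne (by omega), map_zero, smul_zero]
    · rfl
  rw [t1, t2, zero_add, zero_add]
  by_cases h : n = N ∧ m = N ∧ r' = r ∧ l' = l + 1
  · obtain ⟨rfl, rfl, rfl, rfl⟩ := h
    rw [if_pos (by omega), Nat.add_sub_cancel, single_self, single_self]
  · rw [single_ne h]
    split_ifs with h'
    · rw [single_ne (by omega), map_zero, smul_zero]
    · rfl

theorem sigma_diag0 (N l : ℕ) (F : WSp) : sigmaM (singleSlot N N 0 l F) = 0 := by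
  funext n m r' l'
  rw [sigma_eq]
  have t1 : (if 1 ≤ m ∧ m - 1 < n + 1 then cA (n + 1) (m - 1) r' l' •
      eDU (singleSlot N N 0 l F (n + 1) (m - 1) r' l') else 0) = 0 := by
    split_ifs with h
    · rw [single_ne (by omega), map_zero, smul_zero]
    · rfl
  have t2 : (if 1 ≤ n ∧ n - 1 < m + 1 then cB (n - 1) (m + 1) r' l' •
      eUD (singleSlot N N 0 l F (n - 1) (m + 1) r' l') else 0) = 0 := by
    split_ifs with h
    · rw [single_ne (by omega), map_zero, smul_zero]
    · rfl
  rw [t1, t2, zero_add, zero_add, single_ne (by omega), map_zero, smul_zero, ite_self]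
  rfl

theorem sigma_low (N l : ℕ) (F : WSp) :
    sigmaM (singleSlot N (N + 2) 0 l F) =
      singleSlot (N + 1) (N + 1) 0 l (cB N (N + 2) 0 l • eUD F) := by
  funext n m r' l'
  rw [sigma_eq]
  have t1 : (if 1 ≤ m ∧ m - 1 < n + 1 then cA (n + 1) (m - 1) r' l' •
      eDU (singleSlot N (N + 2) 0 l F (n + 1) (m - 1) r' l') else 0) = 0 := by
    split_ifs with h
    · rw [single_ne (by omega), map_zero, smul_zero]
    · rfl
  rw [t1, zero_add, single_ne (n' := n) (r' := r' + 1) (by omega), map_zero, smul_zero, ite_self,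
    add_zero]
  by_cases h : n = N + 1 ∧ m = N + 1 ∧ r' = 0 ∧ l' = l
  · obtain ⟨rfl, rfl, rfl, rfl⟩ := h
    rw [if_pos (by omega), Nat.add_sub_cancel, single_self, single_self]
  · rw [single_ne h]
    split_ifs with h'
    · rw [single_ne (by omega), map_zero, smul_zero]
    · rfl

theorem sigma_high (N l : ℕ) (F : WSp) :
    sigmaM (singleSlot (N + 2) N 0 l F) =
      singleSlot (N + 1) (N + 1) 0 l (cA (N + 2) N 0 l • eDU F) := by
  funext n m r' l'
  rw [sigma_eq]
  have t1 : (if 1 ≤ n ∧ n - 1 < m + 1 then cB (n - 1) (m + 1) r' l' •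
      eUD (singleSlot (N + 2) N 0 l F (n - 1) (m + 1) r' l') else 0) = 0 := by
    split_ifs with h
    · rw [single_ne (by omega), map_zero, smul_zero]
    · rfl
  rw [t1, single_ne (n' := n) (r' := r' + 1) (by omega), map_zero, smul_zero, ite_self,
    add_zero, add_zero]
  by_cases h : n = N + 1 ∧ m = N + 1 ∧ r' = 0 ∧ l' = l
  · obtain ⟨rfl, rfl, rfl, rfl⟩ := h
    rw [if_pos (by omega), Nat.add_sub_cancel, single_self, single_self]
  · rw [single_ne h]
    split_ifs with h'
    · rw [single_ne (by omega), map_zero, smul_zero]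
    · rfl

theorem eUD_bot {F : WSp} (hF : FormDeg 0 F) (h : Bihom 0 0 F) : eUD F = 0 := by
  apply one_form_zero (eUD_formDeg hF) (eUD_bihom h) (pa_eUD F) (pb_eUD F) _ (pd_eUD F)
  rw [pc_eUD (h ∅)]
  simp

theorem eDU_bot {F : WSp} (hF : FormDeg 0 F) (h : Bihom 0 0 F) : eDU F = 0 := by
  apply one_form_zero (eDU_formDeg hF) (eDU_bihom h) (pa_eDU F) _ (pc_eDU F) (pd_eDU F)
  rw [pb_eDU (h ∅)]
  simp

section
variable {N L lh lv : ℕ} {G : WSp}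

/-- A diagonal slot with no mixed components and `l = 0` or no `e(∂,∂̄)` component. -/
theorem gauge_single {r l : ℕ} {F : WSp} (hb : pb F = 0) (hc : pc F = 0)
    (hd : pd F = 0 ∨ l = 0) : Gauge N (singleSlot N N r l F) where
  g1 n m r' l' _ _ := by rw [p_single, hb, ite_self]
  g2 n m r' l' _ _ := by rw [p_single, hc, ite_self]
  g3 r' l' h := by
    rcases hd with hd | hd
    · rw [p_single, hd, ite_self]
    · rw [p_single, if_neg (by omega)]

theorem good_i (hlh : lh = N + N) (hlv : lv = L + L) (hG : FormDeg 0 G)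
    (hB : Bihom (N + L + 1) (N + L + 1) G) : Good lh lv N (singleSlot N N L 0 (eDD G)) where
  fam := isFam_single (eDD_formDeg hG) (eDD_bihom hB) hlh.symm (by omega)
  closed := by
    rcases L with _ | L
    · exact sigma_diag0 _ _ _
    · rw [sigma_diag, sq_DD hG, smul_zero, single_zero]
  gauge := gauge_single (pb_eDD G) (pc_eDD G) (Or.inr rfl)

theorem good_ii (hlh : lh = N + N) (hlv : lv = L + L) (hN : 1 ≤ N) (hG : FormDeg 0 G)
    (hB : Bihom (N - 1) (N - 1) G) : Good lh lv N (singleSlot N N 0 L (eUU G)) where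
  fam := by
    have := eUU_bihom hB
    rw [Nat.sub_add_cancel hN] at this
    exact isFam_single (eUU_formDeg hG) this hlh.symm (by omega)
  closed := sigma_diag0 _ _ _
  gauge := gauge_single (pb_eUU G) (pc_eUU G) (Or.inl (pd_eUU G))

theorem gen_iii_zero (hG : FormDeg 0 G) (hB : Bihom 0 0 G) :
    Good 0 (L + 1 + (L + 1)) 0 (singleSlot 0 0 1 L (eUU G)) where
  fam := isFam_single (eUU_formDeg hG) (eUU_bihom hB) rfl (by omega)
  closed := by
    rw [sigma_diag 0 0 L]
    have h := mix_UU hG hB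
    rw [eUD_bot hG hB, eDU_bot hG hB, map_zero, map_zero, add_zero, smul_zero, zero_add] at h
    rw [(smul_eq_zero_iff_right (by norm_num)).mp h, smul_zero, single_zero]
  gauge := gauge_single (pb_eUU G) (pc_eUU G) (Or.inl (pd_eUU G))

theorem coef_iii (N L : ℕ) :
    ((((N + 1) + (N + 1) : ℕ) : ℂ) /
      ((((N + 1) + (N + 1) : ℕ) : ℂ) + (((L + 1) + (L + 1) : ℕ) : ℂ) + 2)) * cA (N + 2) N 0 (L + 1)
      = ((N : ℂ) + 2) / (N + 3) ∧
    ((((N + 1) + (N + 1) : ℕ) : ℂ) /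
      ((((N + 1) + (N + 1) : ℕ) : ℂ) + (((L + 1) + (L + 1) : ℕ) : ℂ) + 2)) * cB N (N + 2) 0 (L + 1)
      = ((N : ℂ) + 2) / (N + 3) ∧
    cG (N + 1) (N + 1) 1 = -2 * ((N : ℂ) + 2) / ((N + 3) * (N + 3)) := by
  have e1 : ((N : ℂ) + 1) ≠ 0 := by exact_mod_cast (show (N + 1 : ℕ) ≠ 0 by omega)
  have e3 : ((N : ℂ) + 3) ≠ 0 := by exact_mod_cast (show (N + 3 : ℕ) ≠ 0 by omega)
  have e4 : ((N : ℂ) + L + 3) ≠ 0 := by exact_mod_cast (show (N + L + 3 : ℕ) ≠ 0 by omega)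
  have e5 : ((N : ℂ) + 1 + (N + 1) + (L + 1 + (L + 1)) + 2) = 2 * (N + L + 3) := by ring
  unfold cA cB cG
  push_cast
  rw [e5]
  have e6 : ((N : ℂ) + 2 + 0 + 1) = N + 3 := by ring
  have e7 : ((N : ℂ) + 0 + 1) = N + 1 := by ring
  have e8 : ((N : ℂ) + 1 + 1 + 1) = N + 3 := by ring
  rw [e6, e7, e8]
  refine ⟨?_, ?_, ?_⟩
  · field_simp
    ring
  · field_simp
    ring
  · field_simp
    ring

theorem gen_iii_succ (hG : FormDeg 0 G) (hB : Bihom (N + 1) (N + 1) G) (k : ℂ)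
    (hk : k = ((((N + 1) + (N + 1) : ℕ) : ℂ) /
      ((((N + 1) + (N + 1) : ℕ) : ℂ) + (((L + 1) + (L + 1) : ℕ) : ℂ) + 2))) :
    Good (N + 1 + (N + 1)) (L + 1 + (L + 1)) (N + 1)
      (singleSlot (N + 1) (N + 1) 1 L (eUU G) + k •
        (singleSlot N (N + 2) 0 (L + 1) (eDU G) + singleSlot (N + 2) N 0 (L + 1) (eUD G))) where
  fam := by
    refine IsFam.add ?_ (IsFam.smul _ (IsFam.add ?_ ?_))
    · exact isFam_single (eUU_formDeg hG) (eUU_bihom hB) rfl (by omega)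
    · exact isFam_single (eDU_formDeg hG) (eDU_bihom hB) (by omega) (by omega)
    · exact isFam_single (eUD_formDeg hG) (eUD_bihom hB) (by omega) (by omega)
  closed := by
    obtain ⟨c1, c2, c3⟩ := coef_iii N L
    rw [← sigL_apply, map_add, map_smul, map_add]
    simp only [sigL_apply]
    rw [sigma_diag (N + 1) 0 L, sigma_low, sigma_high, single_add, single_smul, single_add,
      smul_add, smul_smul, smul_smul, hk, c1, c2, zero_add, c3]
    have h := mix_UU hG hB
    have e3 : ((N : ℂ) + 3) ≠ 0 := by exact_mod_cast (show (N + 3 : ℕ) ≠ 0 by omega)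
    have h2 := congrArg (fun x => (((N : ℂ) + 2) / ((N + 3) * (N + 3))) • x) h
    simp only [smul_zero, smul_add, smul_smul] at h2
    rw [show ((N : ℂ) + 2) / ((N + 3) * (N + 3)) * (((N + 1 : ℕ) : ℂ) + 2) = (N + 2) / (N + 3) by
      push_cast
      field_simp
      ring, show ((N : ℂ) + 2) / ((N + 3) * (N + 3)) * -2 = -2 * (N + 2) / ((N + 3) * (N + 3)) by
      ring] at h2
    rw [← single_zero (N + 1) (N + 1) 0 (L + 1), ← h2]
    congr 1
    abel
  gauge := by
    refine Gauge.add (gauge_single (pb_eUU G) (pc_eUU G) (Or.inl (pd_eUU G)))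
      (Gauge.smul _ (Gauge.add ⟨?_, ?_, ?_⟩ ⟨?_, ?_, ?_⟩))
    · intro n m r l h h'
      rw [p_single, if_neg (by omega)]
    · intro n m r l h h'
      rw [p_single, pc_eDU, ite_self]
    · intro r l h
      rw [p_single, pd_eDU, ite_self]
    · intro n m r l h h'
      rw [p_single, pb_eUD, ite_self]
    · intro n m r l h h'
      rw [p_single, if_neg (by omega)]
    · intro r l h
      rw [p_single, pd_eUD, ite_self]

end

theorem C1_good {lh lv N L : ℕ} (hlh : lh = N + N) (hlv : lv = L + L) {x : Fam}
    (hx : x ∈ C1 lh lv) : Good lh lv N x := by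
  unfold C1 at hx
  induction hx using Submodule.span_induction with
  | zero => exact Good.zero _ _ _
  | add x y _ _ hx hy => exact hx.add hy
  | smul c x _ hx => exact hx.smul c
  | mem x hx =>
    rcases hx with (⟨G, hG, hB, rfl⟩ | ⟨h2, G, hG, hB, rfl⟩) | ⟨h2, G, hG, hB, rfl⟩
    · rw [show (lh + lv) / 2 + 1 = N + L + 1 by omega] at hB
      rw [show lh / 2 = N by omega, show lv / 2 = L by omega]
      exact good_i hlh hlv hG hB
    · rw [show lh / 2 - 1 = N - 1 by omega] at hB
      rw [show lh / 2 = N by omega, show lv / 2 = L by omega]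
      exact good_ii hlh hlv (by omega) hG hB
    · rw [show lh / 2 = N by omega] at hB
      rw [show lh / 2 = N by omega, show lv / 2 = L by omega]
      subst hlh
      subst hlv
      obtain ⟨L, rfl⟩ : ∃ L', L = L' + 1 := ⟨L - 1, by omega⟩
      rcases N with _ | N
      · have := gen_iii_zero (L := L) hG hB
        simpa using this
      · exact gen_iii_succ hG hB _ rfl

/-! ### Homogeneity of the projections -/

theorem pb_bh {A B : ℕ} {F : WSp} (h : Bihom A B F) : BH (A + 1) (B - 1) (pb F) := by
  have h' : ∀ S, BH A B (F S) := h
  rw [pb_apply]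
  exact ((((h' _).dy 1).sub ((h' _).dy 0)).xmul 0).add ((((h' _).dy 1).sub ((h' _).dy 0)).xmul 1)

theorem pc_bh {A B : ℕ} {F : WSp} (h : Bihom A B F) : BH (A - 1) (B + 1) (pc F) := by
  have h' : ∀ S, BH A B (F S) := h
  rw [pc_apply]
  exact ((((h' _).dx 1).sub ((h' _).dx 0)).ymul 0).add ((((h' _).dx 1).sub ((h' _).dx 0)).ymul 1)

theorem pa_bh {A B : ℕ} {F : WSp} (h : Bihom A B F) : BH (A - 1) (B - 1) (pa F) := by
  have h' : ∀ S, BH A B (F S) := h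
  rw [pa_apply]
  exact (((((h' _).dy 1).dx 1).sub (((h' _).dy 0).dx 1)).sub (((h' _).dy 1).dx 0)).add
    (((h' _).dy 0).dx 0)

theorem pd_bh {A B : ℕ} {F : WSp} (h : Bihom A B F) : BH (A + 1) (B + 1) (pd F) := by
  have h' : ∀ S, BH A B (F S) := h
  rw [pd_apply]
  simp only [mul_assoc]
  exact (((((h' _).ymul 0).xmul 0).add (((h' _).ymul 1).xmul 0)).add (((h' _).ymul 0).xmul 1)).add
    (((h' _).ymul 1).xmul 1)

/-- A polynomial as a 0-form. -/
def zf (p : Pu) : WSp := fun S => if S = ∅ then p else 0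

theorem zf_form (p : Pu) : FormDeg 0 (zf p) := by
  intro S hS
  apply if_neg
  rintro rfl
  exact hS rfl

theorem zf_bihom {A B : ℕ} {p : Pu} (h : BH A B p) : Bihom A B (zf p) := by
  intro S
  change BH A B (if S = ∅ then p else 0)
  split_ifs
  · exact h
  · exact BH.zero _ _

theorem zf_empty (p : Pu) : zf p ∅ = p := if_pos rfl

theorem zf_zero : zf 0 = 0 := by
  funext S
  simp [zf]

/-! ### Projections of exact families -/

section
variable {lh lv : ℕ} {x : Fam}

theorem pa_sigma (x : Fam) (n m r l : ℕ) : pa (sigmaM x n m r l) = 0 := by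
  rw [sigma_eq]
  simp only [map_add, map_zero, apply_ite pa, map_smul, pa_eDU, pa_eUD, pa_eDD, smul_zero, ite_self,
    add_zero]

theorem pb_sigma (hx : IsFam 0 lh lv x) (n m r l : ℕ) (h : 1 ≤ m) (h' : m ≤ n + 1) :
    pb (sigmaM x n m r l) = (cA (n + 1) (m - 1) r l *
      -(((n + 1 + r : ℕ) : ℂ) * (((m - 1 + r : ℕ) : ℂ) + 2))) • x (n + 1) (m - 1) r l ∅ := by
  rw [sigma_eq]
  simp only [map_add, map_zero, apply_ite pb, map_smul, pb_eUD, pb_eDD, smul_zero, ite_self,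
    add_zero]
  rw [if_pos (by omega), pb_eDU (hx.bh _ _ _ _ ∅), smul_smul]

theorem pc_sigma (hx : IsFam 0 lh lv x) (n m r l : ℕ) (h : 1 ≤ n) (h' : n ≤ m + 1) :
    pc (sigmaM x n m r l) = (cB (n - 1) (m + 1) r l *
      -((((n - 1 + r : ℕ) : ℂ) + 2) * ((m + 1 + r : ℕ) : ℂ))) • x (n - 1) (m + 1) r l ∅ := by
  rw [sigma_eq]
  simp only [map_add, map_zero, apply_ite pc, map_smul, pc_eDU, pc_eDD, smul_zero, ite_self,
    add_zero, zero_add]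
  rw [if_pos (by omega), pc_eUD (hx.bh _ _ _ _ ∅), smul_smul]

theorem pd_sigma (hx : IsFam 0 lh lv x) (n m r l : ℕ) (h : 1 ≤ l) :
    pd (sigmaM x n m r l) = (cG n m (r + 1) *
      (((n + (r + 1) : ℕ) : ℂ) * ((m + (r + 1) : ℕ) : ℂ))) • x n m (r + 1) (l - 1) ∅ := by
  rw [sigma_eq]
  simp only [map_add, map_zero, apply_ite pd, map_smul, pd_eDU, pd_eUD, smul_zero, ite_self,
    add_zero, zero_add]
  rw [if_pos h, pd_eDD (hx.bh _ _ _ _ ∅), smul_smul]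

theorem pd_sigma0 (x : Fam) (n m r : ℕ) : pd (sigmaM x n m r 0) = 0 := by
  rw [sigma_eq]
  simp only [map_add, map_zero, apply_ite pd, map_smul, pd_eDU, pd_eUD, smul_zero, ite_self,
    add_zero, zero_add]
  rw [if_neg (by omega)]

end

/-! ### The gauge-fixing family -/

def Epoly (w : Fam) (n m r l : ℕ) : Pu :=
  if m < n then (cA n m r l * -(((n + r : ℕ) : ℂ) * (((m + r : ℕ) : ℂ) + 2)))⁻¹ •
    pb (w (n - 1) (m + 1) r l)
  else if n < m then (cB n m r l * -((((n + r : ℕ) : ℂ) + 2) * ((m + r : ℕ) : ℂ)))⁻¹ •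
    pc (w (n + 1) (m - 1) r l)
  else if 1 ≤ r then (cG n m r * (((n + r : ℕ) : ℂ) * ((m + r : ℕ) : ℂ)))⁻¹ •
    pd (w n m (r - 1) (l + 1))
  else 0

def Efam (w : Fam) : Fam := fun n m r l => zf (Epoly w n m r l)

theorem Efam_fam {lh lv : ℕ} {w : Fam} (hw : IsFam 1 lh lv w) : IsFam 0 lh lv (Efam w) := by
  intro n m r l
  refine ⟨zf_form _, zf_bihom ?_, fun h => ?_⟩
  · unfold Epoly
    split_ifs with h1 h2 h3
    · have := pb_bh (hw (n - 1) (m + 1) r l).2.1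
      rw [show n - 1 + r + 1 = n + r by omega, show m + 1 + r - 1 = m + r by omega] at this
      exact this.smul _
    · have := pc_bh (hw (n + 1) (m - 1) r l).2.1
      rw [show n + 1 + r - 1 = n + r by omega, show m - 1 + r + 1 = m + r by omega] at this
      exact this.smul _
    · have := pd_bh (hw n m (r - 1) (l + 1)).2.1
      rw [show n + (r - 1) + 1 = n + r by omega, show m + (r - 1) + 1 = m + r by omega] at this
      exact this.smul _
    · exact BH.zero _ _
  · have : Epoly w n m r l = 0 := by
      unfold Epoly
      split_ifs with h1 h2 h3
      · rw [(hw _ _ _ _).2.2 (by omega), map_zero, smul_zero]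
      · rw [(hw _ _ _ _).2.2 (by omega), map_zero, smul_zero]
      · rw [(hw _ _ _ _).2.2 (by omega), map_zero, smul_zero]
      · rfl
    change zf (Epoly w n m r l) = 0
    rw [this, zf_zero]

theorem nat_ne {k : ℕ} (hk : 0 < k) : (k : ℂ) ≠ 0 := Nat.cast_ne_zero.mpr (by omega)

/-- The gauge-fixing family removes the components prescribed by the gauge. -/
theorem Efam_gauge {lh lv N : ℕ} {w : Fam} (hw : IsFam 1 lh lv w) :
    Gauge N (w - sigmaM (Efam w)) where
  g1 n m r l h h' := by
    simp only [Pi.sub_apply, map_sub]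
    rw [pb_sigma (Efam_fam hw) n m r l h h']
    simp only [Efam, zf_empty, Epoly]
    rw [if_pos (by omega), smul_smul, mul_inv_cancel₀, one_smul, Nat.add_sub_cancel,
      Nat.sub_add_cancel h, sub_self]
    exact mul_ne_zero (cA_ne (by omega))
      (neg_ne_zero.mpr (mul_ne_zero (nat_ne (by omega)) (nat_add_two_ne _)))
  g2 n m r l h h' := by
    simp only [Pi.sub_apply, map_sub]
    rw [pc_sigma (Efam_fam hw) n m r l h h']
    simp only [Efam, zf_empty, Epoly]
    rw [if_neg (by omega), if_pos (by omega), smul_smul, mul_inv_cancel₀, one_smul,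
      Nat.add_sub_cancel, Nat.sub_add_cancel h, sub_self]
    exact mul_ne_zero (cB_ne (by omega))
      (neg_ne_zero.mpr (mul_ne_zero (nat_add_two_ne _) (nat_ne (by omega))))
  g3 r l h := by
    simp only [Pi.sub_apply, map_sub]
    rw [pd_sigma (Efam_fam hw) N N r l h]
    simp only [Efam, zf_empty, Epoly]
    rw [if_neg (by omega), if_neg (by omega), if_pos (by omega), smul_smul, mul_inv_cancel₀,
      one_smul, Nat.add_sub_cancel, Nat.sub_add_cancel h, sub_self]
    exact mul_ne_zero (cG_ne (by omega)) (mul_ne_zero (nat_ne (by omega)) (nat_ne (by omega)))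

/-! ### Elements of `C¹` with prescribed components -/

section
variable {N L lh lv : ℕ} {p : Pu}

theorem exists_i (hlh : lh = N + N) (hlv : lv = L + L) (hp : BH (N + L + 1) (N + L + 1) p) :
    ∃ c ∈ C1 lh lv, pd (c N N L 0) = p ∧ ∀ r l, pa (c N N r l) = 0 := by
  have hb := hp.smul ((((N + L + 1 : ℕ) : ℂ) * ((N + L + 1 : ℕ) : ℂ))⁻¹)
  refine ⟨singleSlot N N L 0 (eDD (zf ((((N + L + 1 : ℕ) : ℂ) * ((N + L + 1 : ℕ) : ℂ))⁻¹ • p))),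
    Submodule.subset_span (Or.inl (Or.inl
      ⟨zf ((((N + L + 1 : ℕ) : ℂ) * ((N + L + 1 : ℕ) : ℂ))⁻¹ • p), zf_form _, ?_, ?_⟩)), ?_, ?_⟩
  · rw [show (lh + lv) / 2 + 1 = N + L + 1 by omega]
    exact zf_bihom hb
  · rw [show lh / 2 = N by omega, show lv / 2 = L by omega]
  · rw [single_self, pd_eDD (zf_bihom hb ∅), zf_empty, smul_smul, mul_inv_cancel₀, one_smul]
    exact mul_ne_zero (nat_ne (by omega)) (nat_ne (by omega))
  · intro r l
    rw [p_single, pa_eDD, ite_self]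

theorem exists_ii (hlh : lh = N + N) (hlv : lv = L + L) (hp : BH (N - 1) (N - 1) p)
    (h0 : N = 0 → p = 0) :
    ∃ c ∈ C1 lh lv, pa (c N N 0 L) = p ∧ (1 ≤ L → pa (c N N 1 (L - 1)) = 0) ∧
      pd (c N N L 0) = 0 := by
  by_cases hN : N = 0
  · refine ⟨0, zero_mem _, ?_, fun _ => map_zero _, map_zero _⟩
    rw [h0 hN]
    exact map_zero _
  have hb := hp.smul (((((N - 1 : ℕ) : ℂ) + 2) * (((N - 1 : ℕ) : ℂ) + 2))⁻¹)
  refine ⟨singleSlot N N 0 L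
      (eUU (zf ((((((N - 1 : ℕ) : ℂ) + 2) * (((N - 1 : ℕ) : ℂ) + 2))⁻¹) • p))),
    Submodule.subset_span (Or.inl (Or.inr ⟨by omega,
      zf ((((((N - 1 : ℕ) : ℂ) + 2) * (((N - 1 : ℕ) : ℂ) + 2))⁻¹) • p), zf_form _, ?_, ?_⟩)), ?_, ?_, ?_⟩
  · rw [show lh / 2 = N by omega]
    exact zf_bihom hb
  · rw [show lh / 2 = N by omega, show lv / 2 = L by omega]
  · rw [single_self, pa_eUU (zf_bihom hb ∅), zf_empty, smul_smul, mul_inv_cancel₀, one_smul]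
    exact mul_ne_zero (nat_add_two_ne _) (nat_add_two_ne _)
  · intro h
    rw [p_single, if_neg (by omega)]
  · rw [p_single, pd_eUU, ite_self]

theorem exists_iii (hlh : lh = N + N) (hlv : lv = L + L) (hL : 1 ≤ L) (hp : BH N N p) :
    ∃ c ∈ C1 lh lv, pa (c N N 1 (L - 1)) = p ∧ pa (c N N 0 L) = 0 ∧ pd (c N N L 0) = 0 := by
  have hb := hp.smul ((((N : ℂ) + 2) * ((N : ℂ) + 2))⁻¹)
  generalize hGdef : zf (((((N : ℂ) + 2) * ((N : ℂ) + 2))⁻¹) • p) = G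
  have hG : FormDeg 0 G := hGdef ▸ zf_form _
  have hGb : Bihom N N G := hGdef ▸ zf_bihom hb
  refine ⟨singleSlot N N 1 (L - 1) (eUU G) + ((lh : ℂ) / ((lh : ℂ) + (lv : ℂ) + 2)) •
            (singleSlot (N - 1) (N + 1) 0 L (eDU G) + singleSlot (N + 1) (N - 1) 0 L (eUD G)),
    Submodule.subset_span (Or.inr ⟨by omega, G, hG, ?_, ?_⟩), ?_, ?_, ?_⟩
  · rw [show lh / 2 = N by omega]
    exact hGb
  · rw [show lh / 2 = N by omega, show lv / 2 = L by omega]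
  · simp only [Pi.add_apply, Pi.smul_apply, map_add, map_smul, p_single, pa_eDU, pa_eUD, ite_self,
      smul_zero, add_zero]
    rw [if_pos (by simp), pa_eUU (hGb ∅), ← hGdef, zf_empty, smul_smul, mul_inv_cancel₀, one_smul]
    exact mul_ne_zero (nat_add_two_ne _) (nat_add_two_ne _)
  · simp only [Pi.add_apply, Pi.smul_apply, map_add, map_smul, p_single, pa_eDU, pa_eUD, ite_self,
      smul_zero, add_zero]
    rw [if_neg (by omega)]
  · simp only [Pi.add_apply, Pi.smul_apply, map_add, map_smul, p_single, pd_eDU, pd_eUD, pd_eUU,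
      ite_self, smul_zero, add_zero]

theorem exists_c (hlh : lh = N + N) (hlv : lv = L + L) {w : Fam} (hw : IsFam 1 lh lv w) :
    ∃ c ∈ C1 lh lv, pd (c N N L 0) = pd (w N N L 0) ∧ pa (c N N 0 L) = pa (w N N 0 L) ∧
      (1 ≤ L → pa (c N N 1 (L - 1)) = pa (w N N 1 (L - 1))) := by
  obtain ⟨c1, m1, a1, b1⟩ := exists_i hlh hlv (pd_bh (hw N N L 0).2.1)
  obtain ⟨c2, m2, a2, b2, d2⟩ := exists_ii hlh hlv (p := pa (w N N 0 L))
    (pa_bh (hw N N 0 L).2.1) (by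
      rintro rfl
      exact pa_bot (hw 0 0 0 L).2.1)
  obtain ⟨c3, m3, a3, b3, d3⟩ : ∃ c ∈ C1 lh lv,
      (1 ≤ L → pa (c N N 1 (L - 1)) = pa (w N N 1 (L - 1))) ∧ pa (c N N 0 L) = 0 ∧
      pd (c N N L 0) = 0 := by
    by_cases hL : 1 ≤ L
    · obtain ⟨c3, m3, a3, b3⟩ := exists_iii hlh hlv hL (pa_bh (hw N N 1 (L - 1)).2.1)
      exact ⟨c3, m3, fun _ => a3, b3⟩
    · exact ⟨0, zero_mem _, fun h => absurd h hL, map_zero _, map_zero _⟩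
  refine ⟨c1 + c2 + c3, add_mem (add_mem m1 m2) m3, ?_, ?_, ?_⟩
  · simp only [Pi.add_apply, map_add, a1, d2, d3, add_zero]
  · simp only [Pi.add_apply, map_add, b1, a2, b3, add_zero, zero_add]
  · intro h
    simp only [Pi.add_apply, map_add, b1, b2 h, a3 h, add_zero, zero_add]

end

/-- `C¹` consists of `(λ_h,λ_v)`-families of 1-forms annihilated by σ₋;
a 1-form family is σ₋-closed iff it is the sum of an element of `C¹` and a σ₋-exact
family; and no nonzero element of `C¹` is σ₋-exact (so the natural map from `C¹` to
`ker σ₋ / Im σ₋ = H¹(σ₋)` is a ℂ-linear isomorphism). -/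
theorem stmt17 (lh lv : ℕ) (hlh : Even lh) (hlv : Even lv) :
    (∀ x ∈ C1 lh lv, IsFam 1 lh lv x ∧ sigmaM x = 0) ∧
    (∀ ω : Fam, IsFam 1 lh lv ω →
      (sigmaM ω = 0 ↔
        ∃ c ∈ C1 lh lv, ∃ ℰ : Fam, IsFam 0 lh lv ℰ ∧ ω = c + sigmaM ℰ)) ∧
    (∀ c ∈ C1 lh lv, (∃ ℰ : Fam, IsFam 0 lh lv ℰ ∧ c = sigmaM ℰ) → c = 0) := by
  obtain ⟨N, hN⟩ := hlh
  obtain ⟨L, hL⟩ := hlv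
  have hlh : Even lh := ⟨N, hN⟩
  refine ⟨fun x hx => ⟨(C1_good hN hL hx).fam, (C1_good hN hL hx).closed⟩, fun w hw => ⟨?_, ?_⟩, ?_⟩
  · intro hs
    obtain ⟨c, hc, c1, c2, c3⟩ := exists_c hN hL hw
    have hgood := C1_good hN hL hc
    have hE := Efam_fam hw
    refine ⟨c, hc, Efam w, hE, ?_⟩
    have hz : (w - sigmaM (Efam w)) + (-1 : ℂ) • c = 0 := by
      refine gauge_unique hN hL ((hw.sub hE.sigma).add (hgood.fam.smul _)) ?_
        ((Efam_gauge hw).add (hgood.gauge.smul _)) ?_ ?_ ?_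
      · rw [← sigL_apply, map_add, map_sub, map_smul]
        simp only [sigL_apply]
        rw [hs, sigma_sq hlh hE, hgood.closed, smul_zero, add_zero, sub_zero]
      · simp only [Pi.add_apply, Pi.sub_apply, Pi.smul_apply, map_add, map_sub, map_smul,
          pd_sigma0, c1, neg_one_smul, Pi.neg_apply, map_neg, sub_zero, add_neg_cancel]
      · simp only [Pi.add_apply, Pi.sub_apply, Pi.smul_apply, map_add, map_sub, map_smul,
          pa_sigma, c2, neg_one_smul, Pi.neg_apply, map_neg, sub_zero, add_neg_cancel]
      · intro h
        simp only [Pi.add_apply, Pi.sub_apply, Pi.smul_apply, map_add, map_sub, map_smul,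
          pa_sigma, c3 h, neg_one_smul, Pi.neg_apply, map_neg, sub_zero, add_neg_cancel]
    rw [neg_one_smul, ← sub_eq_add_neg, sub_eq_zero] at hz
    rw [← hz, sub_add_cancel]
  · rintro ⟨c, hc, x, hx, rfl⟩
    rw [← sigL_apply, map_add]
    simp only [sigL_apply]
    rw [(C1_good hN hL hc).closed, sigma_sq hlh hx, add_zero]
  · rintro c hc ⟨x, hx, rfl⟩
    have hgood := C1_good hN hL hc
    exact gauge_unique hN hL hgood.fam hgood.closed hgood.gauge (pd_sigma0 _ _ _ _)
      (pa_sigma _ _ _ _ _) (fun _ => pa_sigma _ _ _ _ _)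

end
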